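/- arXiv:2411.16069 — 2 statements merged into one kernel-verified Lean document; each statement's English description precedes it below -/
import Mathlib

section
/- For every ε > 0 there exists a constant C > 0 such that for all sufficiently large N, all 𝔄, 𝔅 ⊆ {N+1, …, 2N} with |𝔄||𝔅| ≥ N^{4/3+ε}, all 0 < Δ ≤ 1/2, and each choice of sign σ ∈ {+1, −1}, one has |Σ_{a∈𝔄} Σ_{b∈𝔅} ψ(√(ab) + σΔ)| ≤ C · N · (|𝔄||𝔅|)^{1/4} · (log N)^{3/2}. -/
/-- `ψ(t) = t − ⌊t⌋ − 1/2`. -/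
noncomputable def psiSaw (t : ℝ) : ℝ := t - ⌊t⌋ - 1 / 2

open Real Finset

/-- The periodic antiderivative `B₂({x}) / 2` of `psiSaw`. -/
noncomputable def psiPrim (x : ℝ) : ℝ := (Int.fract x ^ 2 - Int.fract x + 1 / 6) / 2

/-- `e(x) = exp(2πix)`. -/
noncomputable def expCirc (x : ℝ) : ℂ := Complex.exp ((2 * π * x : ℝ) * Complex.I)

lemma norm_expCirc (x : ℝ) : ‖expCirc x‖ = 1 := Complex.norm_exp_ofReal_mul_I _

lemma expCirc_add (x y : ℝ) : expCirc (x + y) = expCirc x * expCirc y := by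
  rw [expCirc, expCirc, expCirc, ← Complex.exp_add]
  push_cast
  ring_nf

lemma conj_expCirc (x : ℝ) : (starRingEnd ℂ) (expCirc x) = expCirc (-x) := by
  rw [expCirc, expCirc, ← Complex.exp_conj, map_mul, Complex.conj_ofReal, Complex.conj_I]
  push_cast
  ring_nf

lemma expCirc_re (x : ℝ) : (expCirc x).re = cos (2 * π * x) := by
  rw [expCirc, Complex.exp_ofReal_mul_I_re]

lemma norm_expCirc_sub_one_le (x : ℝ) : ‖expCirc x - 1‖ ≤ 2 * π * |x| := by
  have h := Real.norm_exp_I_mul_ofReal_sub_one_le (x := 2 * π * x)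
  rw [mul_comm] at h
  rw [expCirc]
  refine h.trans (le_of_eq ?_)
  rw [Real.norm_eq_abs, abs_mul, abs_of_pos (by positivity)]

lemma continuous_expCirc : Continuous expCirc := by
  unfold expCirc
  fun_prop

lemma exists_fract_add {x δ : ℝ} (hδ : 0 ≤ δ) :
    ∃ n : ℤ, 0 ≤ n ∧ Int.fract (x + δ) = Int.fract x + δ - n := by
  refine ⟨⌊x + δ⌋ - ⌊x⌋, sub_nonneg.2 (Int.floor_mono (by linarith)), ?_⟩
  rw [Int.fract, Int.fract]
  push_cast
  ring

lemma int_mul_sub_one_nonneg (n : ℤ) (hn : 0 ≤ n) : (0 : ℝ) ≤ n * (n - 1) := by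
  have : 0 ≤ n * (n - 1) := by
    rcases hn.eq_or_lt with rfl | h
    · simp
    · exact mul_nonneg hn (by omega)
  exact_mod_cast this

lemma psiPrim_sub_le (x : ℝ) {δ : ℝ} (hδ : 0 ≤ δ) :
    psiPrim (x + δ) - psiPrim x ≤ δ * psiSaw x + δ ^ 2 / 2 := by
  obtain ⟨n, hn, h⟩ := exists_fract_add (x := x) hδ
  have hn' : (0 : ℝ) ≤ n := by exact_mod_cast hn
  have h1 := int_mul_sub_one_nonneg n hn
  have h2 := mul_nonneg hn' (Int.fract_nonneg (x + δ))
  have h3 : psiSaw x = Int.fract x - 1 / 2 := rfl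
  rw [h] at h2
  rw [psiPrim, psiPrim, h, h3]
  nlinarith

lemma le_psiPrim_sub (x : ℝ) {δ : ℝ} (hδ : 0 ≤ δ) :
    δ * psiSaw (x + δ) - δ ^ 2 / 2 ≤ psiPrim (x + δ) - psiPrim x := by
  obtain ⟨n, hn, h⟩ := exists_fract_add (x := x) hδ
  have hn' : (0 : ℝ) ≤ n := by exact_mod_cast hn
  have h1 := int_mul_sub_one_nonneg n hn
  have h2 := mul_nonneg hn' (sub_nonneg.2 (Int.fract_lt_one x).le)
  have h3 : psiSaw (x + δ) = Int.fract (x + δ) - 1 / 2 := rfl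
  rw [psiPrim, psiPrim, h3, h]
  nlinarith

lemma hasSum_psiPrim (x : ℝ) :
    HasSum (fun h : ℕ => 1 / (2 * π ^ 2 * (h : ℝ) ^ 2) * cos (2 * π * (h * x))) (psiPrim x) := by
  have h := hasSum_one_div_nat_pow_mul_cos one_ne_zero
    (⟨Int.fract_nonneg x, (Int.fract_lt_one x).le⟩ : Int.fract x ∈ Set.Icc (0 : ℝ) 1)
  have h' := h.mul_left (1 / (2 * π ^ 2))
  have hcos (n : ℕ) : cos (2 * π * (n * x)) = cos (2 * π * n * Int.fract x) := by
    rw [← cos_sub_int_mul_two_pi (2 * π * (n * x)) (n * ⌊x⌋), Int.fract]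
    congr 1
    push_cast
    ring
  have hterm : (fun n : ℕ => 1 / (2 * π ^ 2 * (n : ℝ) ^ 2) * cos (2 * π * (n * x))) =
      fun n : ℕ => 1 / (2 * π ^ 2) * (1 / (n : ℝ) ^ (2 * 1) * cos (2 * π * n * Int.fract x)) := by
    funext n
    rw [hcos]
    ring
  have hB : Polynomial.eval (Int.fract x) (Polynomial.map (algebraMap ℚ ℝ)
      (Polynomial.bernoulli (2 * 1))) = Int.fract x ^ 2 - Int.fract x + 1 / 6 := by
    norm_num [Polynomial.bernoulli, Finset.sum_range_succ, bernoulli_two]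
    ring
  rw [hB] at h'
  rw [hterm]
  have hval : psiPrim x = 1 / (2 * π ^ 2) * ((-1) ^ (1 + 1) * (2 * π) ^ (2 * 1) / 2 /
      (2 * 1).factorial * (Int.fract x ^ 2 - Int.fract x + 1 / 6)) := by
    rw [psiPrim]
    norm_num
    field_simp
  rw [hval]
  exact h'

/-- The Fourier coefficients of the difference quotient of `psiPrim` with step `δ`. -/
noncomputable def psiCoeff (δ : ℝ) (h : ℕ) : ℂ :=
  (1 / (2 * π ^ 2 * δ * (h : ℝ) ^ 2) : ℝ) * (expCirc (h * δ) - 1)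

lemma hasSum_psiCoeff (δ x : ℝ) :
    HasSum (fun h : ℕ => (psiCoeff δ h * expCirc (h * x)).re)
      ((psiPrim (x + δ) - psiPrim x) / δ) := by
  have h := ((hasSum_psiPrim (x + δ)).sub (hasSum_psiPrim x)).div_const δ
  have hterm (n : ℕ) : (psiCoeff δ n * expCirc (n * x)).re =
      (1 / (2 * π ^ 2 * (n : ℝ) ^ 2) * cos (2 * π * (n * (x + δ))) -
        1 / (2 * π ^ 2 * (n : ℝ) ^ 2) * cos (2 * π * (n * x))) / δ := by
    have : psiCoeff δ n * expCirc (n * x) = (1 / (2 * π ^ 2 * δ * (n : ℝ) ^ 2) : ℝ) *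
        (expCirc (n * (x + δ)) - expCirc (n * x)) := by
      rw [mul_add, add_comm, expCirc_add, psiCoeff]
      ring
    rw [this, Complex.re_ofReal_mul, Complex.sub_re, expCirc_re, expCirc_re]
    ring
  rw [funext hterm]
  exact h

lemma norm_psiCoeff_le_inv {δ : ℝ} (hδ : 0 < δ) (h : ℕ) : ‖psiCoeff δ h‖ ≤ 1 / h := by
  rcases h.eq_zero_or_pos with rfl | hh
  · simp [psiCoeff]
  have hh' : (0 : ℝ) < h := by exact_mod_cast hh
  rw [psiCoeff, norm_mul, Complex.norm_real, Real.norm_of_nonneg (by positivity)]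
  have h1 := norm_expCirc_sub_one_le (h * δ)
  rw [abs_of_pos (by positivity)] at h1
  calc _ ≤ 1 / (2 * π ^ 2 * δ * (h : ℝ) ^ 2) * (2 * π * (h * δ)) := by gcongr
    _ = 1 / (π * h) := by field_simp
    _ ≤ 1 / h := by
      gcongr
      nlinarith [Real.pi_gt_three]

lemma norm_psiCoeff_le_inv_sq {δ : ℝ} (hδ : 0 < δ) (h : ℕ) :
    ‖psiCoeff δ h‖ ≤ 1 / (δ * (h : ℝ) ^ 2) := by
  rcases h.eq_zero_or_pos with rfl | hh
  · simp [psiCoeff]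
  have hh' : (0 : ℝ) < h := by exact_mod_cast hh
  rw [psiCoeff, norm_mul, Complex.norm_real, Real.norm_of_nonneg (by positivity)]
  have h1 : ‖expCirc (h * δ) - 1‖ ≤ 2 := by
    refine (norm_sub_le _ _).trans ?_
    rw [norm_expCirc, norm_one]
    norm_num
  calc _ ≤ 1 / (2 * π ^ 2 * δ * (h : ℝ) ^ 2) * 2 := by gcongr
    _ = 1 / (π ^ 2 * (δ * (h : ℝ) ^ 2)) := by field_simp
    _ ≤ 1 / (δ * (h : ℝ) ^ 2) := by
      have : 0 < δ * (h : ℝ) ^ 2 := by positivity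
      have hpi : 1 ≤ π ^ 2 := by nlinarith [Real.pi_gt_three]
      exact one_div_le_one_div_of_le this (le_mul_of_one_le_left this.le hpi)

lemma norm_integral_expCirc_le_inv {u : ℝ} (hu : u ≠ 0) (α β : ℝ) :
    ‖∫ t in α..β, expCirc (u * t)‖ ≤ 1 / |u| := by
  have hc : ((2 * π * u : ℝ) * Complex.I : ℂ) ≠ 0 :=
    mul_ne_zero (by exact_mod_cast mul_ne_zero (by positivity) hu) Complex.I_ne_zero
  have hexp (t : ℝ) : expCirc (u * t) = Complex.exp (((2 * π * u : ℝ) * Complex.I : ℂ) * t) := by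
    rw [expCirc]
    push_cast
    ring_nf
  simp_rw [hexp]
  rw [integral_exp_mul_complex hc, ← hexp, ← hexp, norm_div, norm_mul, Complex.norm_I, mul_one,
    Complex.norm_real, Real.norm_eq_abs, abs_mul, abs_of_pos (by positivity : 0 < 2 * π)]
  have hu' : 0 < |u| := abs_pos.2 hu
  calc _ ≤ (2 : ℝ) / (2 * π * |u|) := by
        gcongr
        refine (norm_sub_le _ _).trans ?_
        rw [norm_expCirc, norm_expCirc]
        norm_num
    _ ≤ 1 / |u| := by
        rw [div_le_div_iff₀ (by positivity) hu']
        nlinarith [Real.pi_gt_three]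

lemma norm_integral_expCirc_le_sub {α β : ℝ} (h : α ≤ β) (u : ℝ) :
    ‖∫ t in α..β, expCirc (u * t)‖ ≤ β - α := by
  have := intervalIntegral.norm_integral_le_of_norm_le_const (a := α) (b := β) (C := 1)
    (f := fun t => expCirc (u * t)) fun t _ => (norm_expCirc _).le
  rwa [one_mul, abs_of_nonneg (sub_nonneg.2 h)] at this

lemma half_le_norm_integral_expCirc {u η : ℝ} (hη : 0 ≤ η) (hu : |u| * η ≤ 1 / 13) :
    η / 2 ≤ ‖∫ t in (0 : ℝ)..η, expCirc (u * t)‖ := by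
  have h1 : ‖∫ t in (0 : ℝ)..η, (expCirc (u * t) - 1)‖ ≤ 1 / 2 * |η - 0| := by
    refine intervalIntegral.norm_integral_le_of_norm_le_const fun t ht => ?_
    rw [Set.uIoc_of_le hη] at ht
    refine (norm_expCirc_sub_one_le _).trans ?_
    rw [abs_mul, abs_of_pos ht.1]
    have : |u| * t ≤ 1 / 13 := (mul_le_mul_of_nonneg_left ht.2 (abs_nonneg u)).trans hu
    nlinarith [Real.pi_lt_d2, mul_nonneg (abs_nonneg u) ht.1.le, Real.pi_pos]
  have hcont : Continuous fun t : ℝ => expCirc (u * t) :=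
    continuous_expCirc.comp (continuous_const.mul continuous_id)
  rw [intervalIntegral.integral_sub (hcont.intervalIntegrable _ _)
    (continuous_const.intervalIntegrable _ _)] at h1
  simp only [intervalIntegral.integral_const, sub_zero, abs_of_nonneg hη] at h1
  have h2 : ‖(η • (1 : ℂ))‖ = η := by simp [abs_of_nonneg hη]
  have h3 := norm_sub_norm_le (η • (1 : ℂ)) (∫ t in (0 : ℝ)..η, expCirc (u * t))
  rw [h2, norm_sub_rev] at h3
  linarith

lemma norm_integral_sq_le {f : ℝ → ℂ} (hf : Continuous f) {a η : ℝ} (hη : 0 < η) :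
    ‖∫ t in a..a + η, f t‖ ^ 2 ≤ η * ∫ t in a..a + η, ‖f t‖ ^ 2 := by
  have hle : a ≤ a + η := by linarith
  set m : ℝ := ∫ t in a..a + η, ‖f t‖ with hm
  have h1 : ‖∫ t in a..a + η, f t‖ ≤ m := intervalIntegral.norm_integral_le_integral_norm hle
  have h2 : 0 ≤ ∫ t in a..a + η, (‖f t‖ - m / η) ^ 2 :=
    intervalIntegral.integral_nonneg hle fun t _ => sq_nonneg _
  have h3 : ∫ t in a..a + η, (‖f t‖ - m / η) ^ 2 =
      (∫ t in a..a + η, ‖f t‖ ^ 2) - 2 * (m / η) * m + (m / η) ^ 2 * η := by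
    have : ∀ t, (‖f t‖ - m / η) ^ 2 = ‖f t‖ ^ 2 - 2 * (m / η) * ‖f t‖ + (m / η) ^ 2 :=
      fun t => by ring
    simp_rw [this]
    rw [intervalIntegral.integral_add, intervalIntegral.integral_sub,
      intervalIntegral.integral_const_mul, intervalIntegral.integral_const]
    · simp [hm]
      ring
    all_goals exact Continuous.intervalIntegrable (by fun_prop) _ _
  rw [h3] at h2
  have h4 : m ^ 2 ≤ η * ∫ t in a..a + η, ‖f t‖ ^ 2 := by
    have := mul_nonneg hη.le h2
    field_simp at this
    linarith
  exact (pow_le_pow_left₀ (norm_nonneg _) h1 2).trans h4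

lemma integral_norm_sum_sq_le {ι : Type*} (s : Finset ι) (d : ι → ℂ) (l : ι → ℝ) (α β : ℝ) :
    ∫ t in α..β, ‖∑ i ∈ s, d i * expCirc (l i * t)‖ ^ 2 ≤
      ∑ i ∈ s, ∑ j ∈ s, ‖d i‖ * ‖d j‖ * ‖∫ t in α..β, expCirc ((l i - l j) * t)‖ := by
  have hpt (t : ℝ) : ((‖∑ i ∈ s, d i * expCirc (l i * t)‖ ^ 2 : ℝ) : ℂ) =
      ∑ i ∈ s, ∑ j ∈ s, d i * (starRingEnd ℂ) (d j) * expCirc ((l i - l j) * t) := by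
    push_cast
    rw [← Complex.mul_conj', map_sum, Finset.sum_mul_sum]
    refine sum_congr rfl fun i _ => sum_congr rfl fun j _ => ?_
    rw [map_mul, conj_expCirc, sub_mul, sub_eq_add_neg, expCirc_add]
    ring
  have hcont (u : ℝ) : Continuous fun t : ℝ => expCirc (u * t) :=
    continuous_expCirc.comp (continuous_const.mul continuous_id)
  have hint : ((∫ t in α..β, ‖∑ i ∈ s, d i * expCirc (l i * t)‖ ^ 2 : ℝ) : ℂ) =
      ∑ i ∈ s, ∑ j ∈ s,
        d i * (starRingEnd ℂ) (d j) * ∫ t in α..β, expCirc ((l i - l j) * t) := by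
    rw [← intervalIntegral.integral_ofReal]
    simp_rw [hpt]
    rw [intervalIntegral.integral_finsetSum]
    · refine sum_congr rfl fun i _ => ?_
      rw [intervalIntegral.integral_finsetSum]
      · simp_rw [intervalIntegral.integral_const_mul]
      · exact fun j _ => (continuous_const.mul (hcont _)).intervalIntegrable _ _
    · exact fun i _ => (continuous_finsetSum _ fun j _ =>
        continuous_const.mul (hcont _)).intervalIntegrable _ _
  calc _ ≤ ‖((∫ t in α..β, ‖∑ i ∈ s, d i * expCirc (l i * t)‖ ^ 2 : ℝ) : ℂ)‖ := by
        rw [Complex.norm_real]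
        exact le_abs_self _
    _ ≤ _ := by
        rw [hint]
        refine norm_sum_le_of_le _ fun i _ => norm_sum_le_of_le _ fun j _ => ?_
        rw [norm_mul, norm_mul, RCLike.norm_conj]

/-- A large sieve inequality for the frequencies `l i` at points `t k` spaced by at least `η`. -/
lemma sum_norm_sq_le_integral {ι : Type*} (s : Finset ι) (c : ι → ℂ) (l : ι → ℝ) {η : ℝ}
    (hη : 0 < η) (hl : ∀ i ∈ s, |l i| * η ≤ 1 / 13) (t : ℕ → ℝ) {m n : ℕ} (hmn : m ≤ n)
    (ht : ∀ k ∈ Ico m n, t k + η ≤ t (k + 1)) :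
    ∑ k ∈ Ico m n, ‖∑ i ∈ s, c i * expCirc (l i * t k)‖ ^ 2 ≤
      4 / η * ∑ i ∈ s, ∑ j ∈ s, ‖c i‖ * ‖c j‖ *
        ‖∫ x in t m..t n, expCirc ((l i - l j) * x)‖ := by
  have hcont (u : ℝ) : Continuous fun t : ℝ => expCirc (u * t) :=
    continuous_expCirc.comp (continuous_const.mul continuous_id)
  set J : ι → ℂ := fun i => ∫ x in (0 : ℝ)..η, expCirc (l i * x) with hJ
  have hJle : ∀ i ∈ s, η / 2 ≤ ‖J i‖ := fun i hi => half_le_norm_integral_expCirc hη.le (hl i hi)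
  have hJ0 : ∀ i ∈ s, J i ≠ 0 := fun i hi => by
    rw [← norm_pos_iff]
    linarith [hJle i hi]
  set d : ι → ℂ := fun i => c i / J i with hd
  set G : ℝ → ℂ := fun x => ∑ i ∈ s, d i * expCirc (l i * x) with hG
  have hGc : Continuous G := continuous_finsetSum _ fun i _ => continuous_const.mul (hcont _)
  have hF (x : ℝ) : ∑ i ∈ s, c i * expCirc (l i * x) = ∫ y in x..x + η, G y := by
    simp only [hG]
    rw [intervalIntegral.integral_finsetSum (f := fun i y => d i * expCirc (l i * y))
      fun i _ => (continuous_const.mul (hcont _)).intervalIntegrable _ _]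
    refine sum_congr rfl fun i hi => ?_
    have hshift : ∫ y in x..x + η, expCirc (l i * y) = expCirc (l i * x) * J i := by
      have := intervalIntegral.integral_comp_add_right (a := 0) (b := η)
        (fun y => expCirc (l i * y)) x
      rw [zero_add, add_comm η x] at this
      rw [← this, hJ, ← intervalIntegral.integral_const_mul]
      refine intervalIntegral.integral_congr fun y _ => ?_
      simp only [mul_add, expCirc_add]
      ring
    rw [intervalIntegral.integral_const_mul, hshift, hd]
    field_simp [hJ0 i hi]
  have hGint (a b : ℝ) : IntervalIntegrable (fun x => ‖G x‖ ^ 2) MeasureTheory.volume a b :=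
    (hGc.norm.pow 2).intervalIntegrable _ _
  have hk : ∀ k ∈ Ico m n, ‖∑ i ∈ s, c i * expCirc (l i * t k)‖ ^ 2 ≤
      η * ∫ x in t k..t (k + 1), ‖G x‖ ^ 2 := fun k hk => by
    rw [hF]
    refine (norm_integral_sq_le hGc hη).trans (mul_le_mul_of_nonneg_left ?_ hη.le)
    exact intervalIntegral.integral_mono_interval le_rfl (by linarith) (ht k hk)
      (Filter.Eventually.of_forall fun x => by positivity) (hGint _ _)
  have hdle : ∀ i ∈ s, ‖d i‖ ≤ 2 / η * ‖c i‖ := fun i hi => by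
    rw [hd, norm_div, div_le_iff₀ (norm_pos_iff.2 (hJ0 i hi))]
    have := mul_le_mul_of_nonneg_left (hJle i hi) (by positivity : 0 ≤ 2 / η * ‖c i‖)
    refine le_trans (le_of_eq ?_) this
    field_simp
  calc _ ≤ ∑ k ∈ Ico m n, η * ∫ x in t k..t (k + 1), ‖G x‖ ^ 2 := sum_le_sum hk
    _ = η * ∫ x in t m..t n, ‖G x‖ ^ 2 := by
        rw [← mul_sum, intervalIntegral.sum_integral_adjacent_intervals_Ico hmn
          fun k _ => hGint _ _]
    _ ≤ η * ∑ i ∈ s, ∑ j ∈ s, ‖d i‖ * ‖d j‖ *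
          ‖∫ x in t m..t n, expCirc ((l i - l j) * x)‖ := by
        gcongr
        exact integral_norm_sum_sq_le s d l _ _
    _ ≤ η * ∑ i ∈ s, ∑ j ∈ s, (2 / η * ‖c i‖) * (2 / η * ‖c j‖) *
          ‖∫ x in t m..t n, expCirc ((l i - l j) * x)‖ := by
        gcongr with i hi j hj
        · exact hdle i hi
        · exact hdle j hj
    _ = _ := by
        rw [mul_sum, mul_sum]
        refine sum_congr rfl fun i _ => ?_
        rw [mul_sum, mul_sum]
        refine sum_congr rfl fun j _ => ?_
        field_simp
        ring

lemma card_filter_modEq_le (N q v : ℕ) (hq : 0 < q) :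
    (#{x ∈ Ioc N (2 * N) | x ≡ v [MOD q]} : ℝ) ≤ N / q + 1 := by
  have h := Nat.Ioc_filter_modEq_card N (2 * N) hq v
  have hq' : (0 : ℚ) < q := by exact_mod_cast hq
  have h2 : ((#{x ∈ Ioc N (2 * N) | x ≡ v [MOD q]} : ℤ) : ℚ) ≤ N / q + 1 := by
    rw [h, Int.cast_max, max_le_iff]
    constructor
    · have h1 := Int.floor_le ((((2 * N : ℕ) : ℚ) - v) / q)
      have h2 := Int.lt_floor_add_one (((N : ℚ) - v) / q)
      have h3 : (((2 * N : ℕ) : ℚ) - v) / q = (N - v) / q + N / q := by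
        push_cast
        ring
      push_cast at *
      linarith
    · push_cast
      positivity
  have h3 : ((#{x ∈ Ioc N (2 * N) | x ≡ v [MOD q]} : ℚ) : ℝ) ≤ ((N / q + 1 : ℚ) : ℝ) := by
    exact_mod_cast h2
  push_cast at h3
  exact h3

lemma card_filter_sq_mul_sub_eq_le (N u v : ℕ) (hv : 0 < v) (huv : Nat.Coprime u v) (m : ℤ) :
    (#{p ∈ Ioc N (2 * N) ×ˢ Ioc N (2 * N) |
      (u : ℤ) ^ 2 * (p.1 : ℕ) - (v : ℤ) ^ 2 * (p.2 : ℕ) = m} : ℝ) ≤ N / (v : ℝ) ^ 2 + 1 := by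
  set S := {p ∈ Ioc N (2 * N) ×ˢ Ioc N (2 * N) |
    (u : ℤ) ^ 2 * (p.1 : ℕ) - (v : ℤ) ^ 2 * (p.2 : ℕ) = m} with hS
  rcases S.eq_empty_or_nonempty with h | ⟨p₀, hp₀⟩
  · rw [h]
    simp only [card_empty, Nat.cast_zero]
    positivity
  have hv2 : 0 < v ^ 2 := by positivity
  have hcard : #S ≤ #{x ∈ Ioc N (2 * N) | x ≡ p₀.1 [MOD v ^ 2]} := by
    refine card_le_card_of_injOn Prod.fst ?_ ?_
    · intro p hp
      simp only [hS, coe_filter, Set.mem_ofPred_eq, mem_filter, mem_product] at hp hp₀ ⊢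
      refine ⟨hp.1.1, ?_⟩
      have hdvd : ((v ^ 2 : ℕ) : ℤ) ∣ (u : ℤ) ^ 2 * (p₀.1 - p.1) :=
        ⟨p₀.2 - p.2, by push_cast; linear_combination hp₀.2 - hp.2⟩
      have hcop : IsCoprime ((v ^ 2 : ℕ) : ℤ) ((u : ℤ) ^ 2) := by
        have := (Nat.Coprime.pow 2 2 huv.symm)
        exact_mod_cast Nat.isCoprime_iff_coprime.2 this
      exact (Nat.modEq_iff_dvd).2 (hcop.dvd_of_dvd_mul_left hdvd)
    · intro p hp p' hp' h
      simp only [hS, coe_filter, Set.mem_ofPred_eq] at hp hp'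
      refine Prod.ext h ?_
      have h1 : (v : ℤ) ^ 2 * (p.2 : ℕ) = (v : ℤ) ^ 2 * (p'.2 : ℕ) := by
        have : (p.1 : ℤ) = (p'.1 : ℕ) := by exact_mod_cast h
        rw [this] at hp
        linarith [hp.2, hp'.2]
      have h2 := mul_left_cancel₀ (by positivity) h1
      exact_mod_cast h2
  have := card_filter_modEq_le N (v ^ 2) p₀.1 hv2
  push_cast at this
  exact (Nat.cast_le.2 hcard).trans this

/-- The weight `6K / r`, with value `1` at `r = 0`. -/
noncomputable def recipWeight (K : ℝ) (r : ℕ) : ℝ := if r = 0 then 1 else 6 * K / r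

lemma recipWeight_nonneg {K : ℝ} (hK : 0 ≤ K) (r : ℕ) : 0 ≤ recipWeight K r := by
  unfold recipWeight
  split_ifs <;> positivity

lemma sum_recipWeight_mul_le {K : ℝ} (hK : 0 ≤ K) {d : ℕ} (hd : 0 < d) (R : ℕ) :
    ∑ k ∈ range (R + 1), recipWeight K (d * k) ≤ 1 + 6 * K / d * (1 + log R) := by
  rw [sum_range_succ', add_comm]
  have h0 : recipWeight K (d * 0) = 1 := by simp [recipWeight]
  have hk (k : ℕ) : recipWeight K (d * (k + 1)) = 6 * K / d * (((k + 1 : ℕ) : ℝ))⁻¹ := by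
    have : d * (k + 1) ≠ 0 := by positivity
    rw [recipWeight, if_neg this]
    push_cast
    field_simp
  simp_rw [h0, hk]
  rw [← mul_sum]
  gcongr
  have := harmonic_le_one_add_log R
  rw [harmonic] at this
  push_cast at this ⊢
  exact this

lemma sum_recipWeight_le {K : ℝ} (hK : 0 ≤ K) (N h h' R : ℕ) (hh : 0 < h) (hh' : 0 < h')
    (hR : h ^ 2 * (2 * N) ≤ R) (hR' : h' ^ 2 * (2 * N) ≤ R) :
    ∑ p ∈ Ioc N (2 * N) ×ˢ Ioc N (2 * N),
      recipWeight K ((h : ℤ) ^ 2 * (p.1 : ℕ) - (h' : ℤ) ^ 2 * (p.2 : ℕ)).natAbs ≤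
    2 * (N * (h.gcd h' : ℝ) ^ 2 / (h' : ℝ) ^ 2 + 1) *
      (1 + 6 * K / (h.gcd h' : ℝ) ^ 2 * (1 + log R)) := by
  obtain ⟨g, u, v, hg, huv, rfl, rfl⟩ := Nat.exists_coprime' (m := h) (n := h')
    (Nat.gcd_pos_of_pos_left _ hh)
  have hu : 0 < u := Nat.pos_of_mul_pos_right hh
  have hv : 0 < v := Nat.pos_of_mul_pos_right hh'
  have hgcd : (u * g).gcd (v * g) = g := by rw [Nat.gcd_mul_right, huv.gcd_eq_one, one_mul]
  rw [hgcd]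
  set f : ℕ × ℕ → ℕ := fun p => ((u : ℤ) ^ 2 * (p.1 : ℕ) - (v : ℤ) ^ 2 * (p.2 : ℕ)).natAbs with hf
  have hfg (p : ℕ × ℕ) : (((u * g : ℕ) : ℤ) ^ 2 * (p.1 : ℕ) -
      ((v * g : ℕ) : ℤ) ^ 2 * (p.2 : ℕ)).natAbs = g ^ 2 * f p := by
    have : ((u * g : ℕ) : ℤ) ^ 2 * (p.1 : ℕ) - ((v * g : ℕ) : ℤ) ^ 2 * (p.2 : ℕ) =
        ((g ^ 2 : ℕ) : ℤ) * ((u : ℤ) ^ 2 * (p.1 : ℕ) - (v : ℤ) ^ 2 * (p.2 : ℕ)) := by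
      push_cast
      ring
    rw [this, Int.natAbs_mul, Int.natAbs_natCast]
  simp_rw [hfg]
  have hmaps : ∀ p ∈ Ioc N (2 * N) ×ˢ Ioc N (2 * N), f p ∈ range (R + 1) := by
    intro p hp
    simp only [mem_product, mem_Ioc] at hp
    have hle (w : ℕ) (x : ℕ) (hx : x ≤ 2 * N) (hw : (w * g) ^ 2 * (2 * N) ≤ R) :
        w ^ 2 * x ≤ R := by
      refine le_trans ?_ hw
      gcongr
      exact Nat.le_mul_of_pos_right w hg
    have h1 := hle u p.1 hp.1.2 hR
    have h2 := hle v p.2 hp.2.2 hR'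
    rw [mem_range]
    simp only [hf]
    zify at h1 h2
    have h3 : (0 : ℤ) ≤ (u : ℤ) ^ 2 * (p.1 : ℕ) := by positivity
    have h4 : (0 : ℤ) ≤ (v : ℤ) ^ 2 * (p.2 : ℕ) := by positivity
    omega
  rw [← sum_fiberwise_of_maps_to hmaps]
  have hfib : ∀ k ∈ range (R + 1),
      ∑ p ∈ Ioc N (2 * N) ×ˢ Ioc N (2 * N) with f p = k, recipWeight K (g ^ 2 * f p) ≤
        2 * (N / (v : ℝ) ^ 2 + 1) * recipWeight K (g ^ 2 * k) := by
    intro k _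
    have hcard : (#{p ∈ Ioc N (2 * N) ×ˢ Ioc N (2 * N) | f p = k} : ℝ) ≤
        2 * (N / (v : ℝ) ^ 2 + 1) := by
      have hsub : {p ∈ Ioc N (2 * N) ×ˢ Ioc N (2 * N) | f p = k} ⊆
          {p ∈ Ioc N (2 * N) ×ˢ Ioc N (2 * N) |
            (u : ℤ) ^ 2 * (p.1 : ℕ) - (v : ℤ) ^ 2 * (p.2 : ℕ) = k} ∪
          {p ∈ Ioc N (2 * N) ×ˢ Ioc N (2 * N) |
            (u : ℤ) ^ 2 * (p.1 : ℕ) - (v : ℤ) ^ 2 * (p.2 : ℕ) = -k} := by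
        intro p hp
        rw [mem_filter] at hp
        rw [mem_union, mem_filter, mem_filter]
        rcases Int.natAbs_eq_iff.1 hp.2 with h | h
        · exact Or.inl ⟨hp.1, h⟩
        · exact Or.inr ⟨hp.1, h⟩
      have h1 := (card_le_card hsub).trans (card_union_le _ _)
      have h2 := card_filter_sq_mul_sub_eq_le N u v hv huv k
      have h3 := card_filter_sq_mul_sub_eq_le N u v hv huv (-k)
      have h4 := (Nat.cast_le (α := ℝ)).2 h1
      push_cast at h4
      linarith
    rw [sum_congr rfl fun p hp => by rw [(mem_filter.1 hp).2], sum_const, nsmul_eq_mul]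
    exact mul_le_mul_of_nonneg_right hcard (recipWeight_nonneg hK _)
  refine (sum_le_sum hfib).trans ?_
  rw [← mul_sum]
  have hg' : (g : ℝ) ≠ 0 := by positivity
  have hv' : (v : ℝ) ≠ 0 := by positivity
  have hNv : (N : ℝ) * (g : ℝ) ^ 2 / ((v * g : ℕ) : ℝ) ^ 2 = N / (v : ℝ) ^ 2 := by
    push_cast
    field_simp
  rw [hNv]
  have := sum_recipWeight_mul_le hK (d := g ^ 2) (by positivity) R
  push_cast at this
  gcongr

lemma sum_gcd_sq_le (K : ℕ) :
    ∑ h ∈ Ico K (2 * K), ∑ h' ∈ Ico K (2 * K), (h.gcd h') ^ 2 ≤ 8 * K ^ 3 := by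
  have hle : ∀ h ∈ Ico K (2 * K), ∀ h' ∈ Ico K (2 * K), (h.gcd h') ^ 2 ≤
      ∑ g ∈ Ioc 0 (2 * K), g ^ 2 * ((if g ∣ h then 1 else 0) * (if g ∣ h' then 1 else 0)) := by
    intro h hh h' _
    rw [mem_Ico] at hh
    have hg : h.gcd h' ∈ Ioc 0 (2 * K) := mem_Ioc.2
      ⟨Nat.gcd_pos_of_pos_left _ (by omega), (Nat.gcd_le_left _ (by omega)).trans hh.2.le⟩
    refine le_trans (le_of_eq ?_) (single_le_sum (fun _ _ => Nat.zero_le _) hg)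
    simp [Nat.gcd_dvd_left, Nat.gcd_dvd_right]
  have hmult (g : ℕ) : ∑ h ∈ Ico K (2 * K), (if g ∣ h then 1 else 0) ≤ 2 * K / g := by
    rw [← card_filter, ← Nat.Ioc_filter_dvd_card_eq_div]
    refine card_le_card (filter_subset_filter _ fun x hx => ?_)
    rw [mem_Ico] at hx
    exact mem_Ioc.2 ⟨by omega, by omega⟩
  calc _ ≤ ∑ h ∈ Ico K (2 * K), ∑ h' ∈ Ico K (2 * K), ∑ g ∈ Ioc 0 (2 * K),
        g ^ 2 * ((if g ∣ h then 1 else 0) * (if g ∣ h' then 1 else 0)) :=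
        sum_le_sum fun h hh => sum_le_sum fun h' hh' => hle h hh h' hh'
    _ = ∑ g ∈ Ioc 0 (2 * K), g ^ 2 * ((∑ h ∈ Ico K (2 * K), (if g ∣ h then 1 else 0)) *
          ∑ h' ∈ Ico K (2 * K), (if g ∣ h' then 1 else 0)) := by
        rw [sum_congr rfl fun h _ => sum_comm, sum_comm]
        refine sum_congr rfl fun g _ => ?_
        rw [sum_mul_sum, mul_sum]
        refine sum_congr rfl fun h _ => ?_
        rw [mul_sum]
    _ ≤ ∑ g ∈ Ioc 0 (2 * K), (2 * K) ^ 2 := by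
        refine sum_le_sum fun g _ => ?_
        calc _ ≤ g ^ 2 * ((2 * K / g) * (2 * K / g)) := by
              gcongr <;> exact hmult g
          _ = (g * (2 * K / g)) ^ 2 := by ring
          _ ≤ _ := by
              exact Nat.pow_le_pow_left (Nat.mul_div_le _ _) 2
    _ = 8 * K ^ 3 := by
        rw [sum_const, Nat.card_Ioc, smul_eq_mul]
        simp
        ring

lemma sum_sum_recipWeight_le (K N : ℕ) (hK : 0 < K) (hN : 0 < N) :
    ∑ h ∈ Ico K (2 * K), ∑ h' ∈ Ico K (2 * K), ∑ p ∈ Ioc N (2 * N) ×ˢ Ioc N (2 * N),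
      recipWeight K ((h : ℤ) ^ 2 * (p.1 : ℕ) - (h' : ℤ) ^ 2 * (p.2 : ℕ)).natAbs ≤
    28 * K * (N + (K : ℝ) ^ 2) * (1 + log (8 * (K : ℝ) ^ 2 * N)) := by
  have hK1 : (1 : ℝ) ≤ K := by exact_mod_cast hK
  have hN1 : (1 : ℝ) ≤ N := by exact_mod_cast hN
  set L : ℝ := 1 + log (8 * (K : ℝ) ^ 2 * N) with hL
  have hL1 : 1 ≤ L := by
    have := one_le_mul_of_one_le_of_one_le (one_le_pow₀ hK1 (n := 2)) hN1
    have : 0 ≤ log (8 * (K : ℝ) ^ 2 * N) := log_nonneg (by linarith)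
    linarith
  have hterm : ∀ h ∈ Ico K (2 * K), ∀ h' ∈ Ico K (2 * K),
      ∑ p ∈ Ioc N (2 * N) ×ˢ Ioc N (2 * N),
        recipWeight K ((h : ℤ) ^ 2 * (p.1 : ℕ) - (h' : ℤ) ^ 2 * (p.2 : ℕ)).natAbs ≤
      2 * N / (K : ℝ) ^ 2 * ((h.gcd h' ^ 2 : ℕ) : ℝ) + 2 * (1 + 6 * N * L / K + 6 * K * L) := by
    intro h hh h' hh'
    rw [mem_Ico] at hh hh'
    have hg : 0 < h.gcd h' := Nat.gcd_pos_of_pos_left _ (by omega)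
    have hR (x : ℕ) (hx : x < 2 * K) : x ^ 2 * (2 * N) ≤ 8 * K ^ 2 * N := by
      calc x ^ 2 * (2 * N) ≤ (2 * K) ^ 2 * (2 * N) := by gcongr
        _ = _ := by ring
    refine (sum_recipWeight_le (by positivity) N h h' (8 * K ^ 2 * N) (by omega) (by omega)
      (hR h hh.2) (hR h' hh'.2)).trans ?_
    set g : ℝ := (h.gcd h' : ℝ) with hgdef
    have hg1 : 1 ≤ g := by rw [hgdef]; exact_mod_cast hg
    have hKh : (K : ℝ) ≤ h' := by exact_mod_cast hh'.1
    push_cast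
    rw [← hL]
    calc _ ≤ 2 * (N * g ^ 2 / (K : ℝ) ^ 2 + 1) * (1 + 6 * K / g ^ 2 * L) := by gcongr
      _ = 2 * N / (K : ℝ) ^ 2 * g ^ 2 + 2 * (1 + 6 * N * L / K + 6 * K * L / g ^ 2) := by
          field_simp
          ring
      _ ≤ _ := by
          gcongr
          exact div_le_self (by positivity) (one_le_pow₀ hg1)
  refine (sum_le_sum fun h hh => sum_le_sum fun h' hh' => hterm h hh h' hh').trans ?_
  have hgcd : (∑ h ∈ Ico K (2 * K), ∑ h' ∈ Ico K (2 * K), ((h.gcd h' ^ 2 : ℕ) : ℝ)) ≤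
      8 * (K : ℝ) ^ 3 := by exact_mod_cast sum_gcd_sq_le K
  have hcardK : #(Ico K (2 * K)) = K := by
    rw [Nat.card_Ico]
    omega
  simp_rw [sum_add_distrib, ← mul_sum]
  simp only [sum_const, hcardK, nsmul_eq_mul]
  calc _ ≤ 2 * N / (K : ℝ) ^ 2 * (8 * (K : ℝ) ^ 3) +
        2 * (K * (K * (1 + 6 * N * L / K + 6 * K * L))) :=
        add_le_add (mul_le_mul_of_nonneg_left hgcd (by positivity)) le_rfl
    _ = 16 * N * K + 12 * N * K * L + 12 * (K : ℝ) ^ 3 * L + 2 * (K : ℝ) ^ 2 := by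
        field_simp
        ring
    _ ≤ 16 * N * K * L + 12 * N * K * L + 12 * (K : ℝ) ^ 3 * L + 2 * (K : ℝ) ^ 3 * L := by
        have h1 : 16 * (N : ℝ) * K ≤ 16 * N * K * L := le_mul_of_one_le_right (by positivity) hL1
        have h2 : (K : ℝ) ^ 2 ≤ (K : ℝ) ^ 3 := pow_le_pow_right₀ hK1 (by norm_num)
        have h3 : (K : ℝ) ^ 3 ≤ (K : ℝ) ^ 3 * L := le_mul_of_one_le_right (by positivity) hL1
        linarith
    _ ≤ _ := by
        have h1 : 0 ≤ (K : ℝ) ^ 3 * L := by positivity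
        linarith

lemma sqrt_le_of_le_two_mul {N a : ℕ} (ha : a ≤ 2 * N) : √(a : ℝ) ≤ 17 / 12 * √(N : ℝ) := by
  rw [Real.sqrt_le_left (by positivity), mul_pow, Real.sq_sqrt (by positivity)]
  have : (a : ℝ) ≤ 2 * N := by exact_mod_cast ha
  have hN : (0 : ℝ) ≤ N := by positivity
  linarith

lemma norm_integral_expCirc_sqrt_le {K N h h' a a' : ℕ} (hN : 0 < N) (hK : 0 < K)
    (hh : h < 2 * K) (hh' : h' < 2 * K) (ha : a ≤ 2 * N) (ha' : a' ≤ 2 * N) :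
    ‖∫ x in √((N + 1 : ℕ) : ℝ)..√((2 * N + 1 : ℕ) : ℝ),
      expCirc ((h * √(a : ℝ) - h' * √(a' : ℝ)) * x)‖ ≤
      √(N : ℝ) * recipWeight K ((h : ℤ) ^ 2 * a - (h' : ℤ) ^ 2 * a').natAbs := by
  have hN' : (0 : ℝ) < N := by exact_mod_cast hN
  have hs : 0 < √(N : ℝ) := Real.sqrt_pos.2 hN'
  set u : ℝ := h * √(a : ℝ) - h' * √(a' : ℝ) with hu
  have hprod : u * (h * √(a : ℝ) + h' * √(a' : ℝ)) =
      (((h : ℤ) ^ 2 * a - (h' : ℤ) ^ 2 * a' : ℤ) : ℝ) := by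
    have h1 := Real.sq_sqrt (Nat.cast_nonneg (α := ℝ) a)
    have h2 := Real.sq_sqrt (Nat.cast_nonneg (α := ℝ) a')
    push_cast
    rw [hu]
    linear_combination (h : ℝ) ^ 2 * h1 - (h' : ℝ) ^ 2 * h2
  rw [recipWeight]
  split_ifs with hr
  · rw [mul_one]
    refine (norm_integral_expCirc_le_sub (Real.sqrt_le_sqrt ?_) u).trans ?_
    · push_cast
      linarith
    · rw [sub_le_iff_le_add, Real.sqrt_le_left (by positivity)]
      have h1 := Real.sq_sqrt hN'.le
      have h2 := Real.sq_sqrt (by positivity : (0 : ℝ) ≤ ((N + 1 : ℕ) : ℝ))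
      push_cast at *
      nlinarith [mul_nonneg hs.le (Real.sqrt_nonneg ((N : ℝ) + 1))]
  · set r : ℤ := (h : ℤ) ^ 2 * a - (h' : ℤ) ^ 2 * a' with hrdef
    have hr0 : 0 < |(r : ℝ)| := abs_pos.2 (by exact_mod_cast Int.natAbs_ne_zero.1 hr)
    have hu0 : u ≠ 0 := by
      rintro h0
      rw [← hprod, h0, zero_mul, abs_zero] at hr0
      exact lt_irrefl _ hr0
    have hcast : (r.natAbs : ℝ) = |(r : ℝ)| := by
      rw [Nat.cast_natAbs, Int.cast_abs]
    refine (norm_integral_expCirc_le_inv hu0 _ _).trans ?_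
    rw [hcast, ← mul_div_assoc, div_le_div_iff₀ (abs_pos.2 hu0) hr0, ← hprod, abs_mul, one_mul,
      mul_comm]
    gcongr
    have hfac (h a : ℕ) (hh : h < 2 * K) (ha : a ≤ 2 * N) :
        h * √(a : ℝ) ≤ 2 * K * (17 / 12 * √(N : ℝ)) := by
      have : (h : ℝ) ≤ 2 * K := by exact_mod_cast hh.le
      exact mul_le_mul this (sqrt_le_of_le_two_mul ha) (Real.sqrt_nonneg _) (by positivity)
    rw [abs_of_nonneg (by positivity)]
    have h1 := hfac h a hh ha
    have h2 := hfac h' a' hh' ha'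
    have h3 : 0 ≤ √(N : ℝ) * K := by positivity
    linarith

lemma sqrt_add_le_sqrt_succ {K N b : ℕ} (hN : 0 < N) (hK : 0 < K) (hb : b ≤ 2 * N) :
    √(b : ℝ) + 1 / (40 * K * √(N : ℝ)) ≤ √((b + 1 : ℕ) : ℝ) := by
  have hN' : (1 : ℝ) ≤ N := by exact_mod_cast hN
  have hK' : (1 : ℝ) ≤ K := by exact_mod_cast hK
  have hs : 1 ≤ √(N : ℝ) := Real.one_le_sqrt.2 hN'
  have hη : 1 / (40 * K * √(N : ℝ)) ≤ 1 / (40 * √(N : ℝ)) := by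
    gcongr
    linarith
  refine (add_le_add le_rfl hη).trans (Real.le_sqrt_of_sq_le ?_)
  set η := 1 / (40 * √(N : ℝ)) with hηdef
  have h1 : η * √(N : ℝ) = 1 / 40 := by
    rw [hηdef]
    field_simp
  have h0 : 0 ≤ η := by positivity
  have h2 : η ≤ 1 / 40 := by nlinarith
  have h3 := Real.sq_sqrt (Nat.cast_nonneg (α := ℝ) b)
  have h4 := mul_le_mul_of_nonneg_left (sqrt_le_of_le_two_mul hb) h0
  push_cast
  nlinarith

lemma sum_norm_sq_block_le {K N : ℕ} (hK : 0 < K) (hN : 0 < N) {A : Finset ℕ}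
    (hA : A ⊆ Ioc N (2 * N)) {c : ℕ → ℂ} {M : ℝ} (hc : ∀ h ∈ Ico K (2 * K), ‖c h‖ ≤ M) :
    ∑ b ∈ Ioc N (2 * N), ‖∑ h ∈ Ico K (2 * K), ∑ a ∈ A, c h * expCirc (h * √(a : ℝ) * √(b : ℝ))‖ ^ 2
      ≤ 4480 * (K : ℝ) ^ 2 * N * (N + (K : ℝ) ^ 2) * M ^ 2 *
        (1 + log (8 * (K : ℝ) ^ 2 * N)) := by
  have hN' : (0 : ℝ) < N := by exact_mod_cast hN
  have hK' : (0 : ℝ) < K := by exact_mod_cast hK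
  have hs : 0 < √(N : ℝ) := Real.sqrt_pos.2 hN'
  have hM : 0 ≤ M := (norm_nonneg _).trans (hc K (mem_Ico.2 ⟨le_rfl, by omega⟩))
  have hIco : Ioc N (2 * N) = Ico (N + 1) (2 * N + 1) := by
    ext x
    simp only [mem_Ioc, mem_Ico]
    omega
  have hls := sum_norm_sq_le_integral (Ico K (2 * K) ×ˢ A) (fun p => c p.1)
    (fun p => p.1 * √(p.2 : ℝ)) (η := 1 / (40 * K * √(N : ℝ))) (by positivity) ?_
    (fun b => √(b : ℝ)) (m := N + 1) (n := 2 * N + 1) (by omega) ?_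
  rotate_left
  · intro p hp
    obtain ⟨hp1, hp2⟩ := mem_product.1 hp
    have h1 : (p.1 : ℝ) ≤ 2 * K := by exact_mod_cast (mem_Ico.1 hp1).2.le
    have h2 := sqrt_le_of_le_two_mul (mem_Ioc.1 (hA hp2)).2
    rw [abs_of_nonneg (by positivity)]
    calc _ ≤ (2 * K * (17 / 12 * √(N : ℝ))) * (1 / (40 * K * √(N : ℝ))) := by gcongr
      _ = 17 / 240 := by
        field_simp
        norm_num
      _ ≤ 1 / 13 := by norm_num
  · intro b hb
    exact sqrt_add_le_sqrt_succ hN hK (by have := (mem_Ico.1 hb).2; omega)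
  rw [← hIco] at hls
  simp_rw [sum_product] at hls
  refine hls.trans ?_
  have hterm : ∀ h ∈ Ico K (2 * K), ∀ h' ∈ Ico K (2 * K),
      ∑ a ∈ A, ∑ a' ∈ A, ‖c h‖ * ‖c h'‖ *
        ‖∫ x in √((N + 1 : ℕ) : ℝ)..√((2 * N + 1 : ℕ) : ℝ),
          expCirc ((h * √(a : ℝ) - h' * √(a' : ℝ)) * x)‖ ≤
      M ^ 2 * √(N : ℝ) * ∑ p ∈ Ioc N (2 * N) ×ˢ Ioc N (2 * N),
        recipWeight K ((h : ℤ) ^ 2 * (p.1 : ℕ) - (h' : ℤ) ^ 2 * (p.2 : ℕ)).natAbs := by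
    intro h hh h' hh'
    rw [← sum_product']
    calc _ ≤ ∑ p ∈ A ×ˢ A, M ^ 2 * √(N : ℝ) *
          recipWeight K ((h : ℤ) ^ 2 * (p.1 : ℕ) - (h' : ℤ) ^ 2 * (p.2 : ℕ)).natAbs := by
          refine sum_le_sum fun p hp => ?_
          obtain ⟨hp1, hp2⟩ := mem_product.1 hp
          rw [sq, mul_assoc (M * M)]
          gcongr
          · exact hc h hh
          · exact hc h' hh'
          · exact norm_integral_expCirc_sqrt_le hN hK (mem_Ico.1 hh).2 (mem_Ico.1 hh').2
              (mem_Ioc.1 (hA hp1)).2 (mem_Ioc.1 (hA hp2)).2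
      _ ≤ ∑ p ∈ Ioc N (2 * N) ×ˢ Ioc N (2 * N), M ^ 2 * √(N : ℝ) *
          recipWeight K ((h : ℤ) ^ 2 * (p.1 : ℕ) - (h' : ℤ) ^ 2 * (p.2 : ℕ)).natAbs :=
          sum_le_sum_of_subset_of_nonneg (product_subset_product hA hA) fun p _ _ =>
            mul_nonneg (by positivity) (recipWeight_nonneg hK'.le _)
      _ = _ := by rw [mul_sum]
  calc _ = 4 / (1 / (40 * K * √(N : ℝ))) * ∑ h ∈ Ico K (2 * K), ∑ h' ∈ Ico K (2 * K),
        ∑ a ∈ A, ∑ a' ∈ A, ‖c h‖ * ‖c h'‖ *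
        ‖∫ x in √((N + 1 : ℕ) : ℝ)..√((2 * N + 1 : ℕ) : ℝ),
          expCirc ((h * √(a : ℝ) - h' * √(a' : ℝ)) * x)‖ := by
        congr 1
        exact sum_congr rfl fun h _ => sum_comm
    _ ≤ 4 / (1 / (40 * K * √(N : ℝ))) * ∑ h ∈ Ico K (2 * K), ∑ h' ∈ Ico K (2 * K),
        M ^ 2 * √(N : ℝ) * ∑ p ∈ Ioc N (2 * N) ×ˢ Ioc N (2 * N),
        recipWeight K ((h : ℤ) ^ 2 * (p.1 : ℕ) - (h' : ℤ) ^ 2 * (p.2 : ℕ)).natAbs := by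
        gcongr with h hh h' hh'
        exact hterm h hh h' hh'
    _ ≤ 4 / (1 / (40 * K * √(N : ℝ))) * (M ^ 2 * √(N : ℝ) *
          (28 * K * (N + (K : ℝ) ^ 2) * (1 + log (8 * (K : ℝ) ^ 2 * N)))) := by
        simp_rw [← mul_sum]
        gcongr
        exact sum_sum_recipWeight_le K N hK hN
    _ = 4480 * K ^ 2 * (√(N : ℝ) ^ 2) * (N + (K : ℝ) ^ 2) * M ^ 2 *
          (1 + log (8 * (K : ℝ) ^ 2 * N)) := by
        field_simp
        ring
    _ = _ := by rw [Real.sq_sqrt hN'.le]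

lemma abs_psiPrim_diff_sub_sum_le {δ : ℝ} (hδ : 0 < δ) (x : ℝ) {H : ℕ} (hH : 0 < H) :
    |(psiPrim (x + δ) - psiPrim x) / δ - ∑ h ∈ range H, (psiCoeff δ h * expCirc (h * x)).re| ≤
      2 / (δ * H) := by
  have hlim := ((hasSum_psiCoeff δ x).tendsto_sum_nat.sub_const
    (∑ h ∈ range H, (psiCoeff δ h * expCirc (h * x)).re)).abs
  refine le_of_tendsto hlim (Filter.eventually_atTop.2 ⟨H, fun n hn => ?_⟩)
  rw [← sum_Ico_eq_sub _ hn]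
  have hterm (h : ℕ) : |(psiCoeff δ h * expCirc (h * x)).re| ≤ 1 / δ * ((h : ℝ) ^ 2)⁻¹ := by
    refine (Complex.abs_re_le_norm _).trans ?_
    rw [norm_mul, norm_expCirc, mul_one]
    refine (norm_psiCoeff_le_inv_sq hδ h).trans (le_of_eq ?_)
    rw [one_div_mul_eq_div, one_div, mul_inv, div_eq_mul_inv, mul_comm]
  refine (abs_sum_le_sum_abs _ _).trans ((sum_le_sum fun h _ => hterm h).trans ?_)
  rw [← mul_sum]
  have hIoo : Ico H n = Ioo (H - 1) n := by
    ext k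
    simp only [mem_Ico, mem_Ioo]
    omega
  have h1 := sum_Ioo_inv_sq_le (α := ℝ) (H - 1) n
  rw [← hIoo, Nat.cast_pred hH, sub_add_cancel] at h1
  calc _ ≤ 1 / δ * (2 / H) := by gcongr
    _ = _ := by field_simp

lemma abs_sum_range_two_pow_le (g : ℕ → ℝ) (hg : g 0 = 0) (J : ℕ) :
    |∑ h ∈ range (2 ^ J), g h| ≤
      ∑ j ∈ range J, |∑ h ∈ Ico (2 ^ j) (2 * 2 ^ j), g h| := by
  induction J with
  | zero => simp [hg]
  | succ J ih =>
    rw [sum_range_succ, pow_succ', range_eq_Ico, ← sum_Ico_consecutive _ (Nat.zero_le (2 ^ J))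
      (by omega), ← range_eq_Ico]
    exact (abs_add_le _ _).trans (add_le_add ih le_rfl)

lemma abs_block_sum_le {N K : ℕ} (hN : 8 ≤ N) (hK : 0 < K) (hKN : K ≤ N) {A B : Finset ℕ}
    (hA : A ⊆ Ioc N (2 * N)) (hB : B ⊆ Ioc N (2 * N)) (y : ℝ) :
    |∑ h ∈ Ico K (2 * K), ∑ a ∈ A, ∑ b ∈ B,
      (psiCoeff (1 / √(N : ℝ)) h * expCirc (h * (√(a * b : ℝ) + y))).re| ≤
      213 * √(#B : ℝ) * N * √(log N) := by
  have hN8 : (8 : ℝ) ≤ N := by exact_mod_cast hN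
  have hN0 : (0 : ℝ) < N := by linarith
  have hK0 : (0 : ℝ) < K := by exact_mod_cast hK
  have hKN' : (K : ℝ) ≤ N := by exact_mod_cast hKN
  have hs : 0 < √(N : ℝ) := Real.sqrt_pos.2 hN0
  have hδ : 0 < 1 / √(N : ℝ) := by positivity
  set c : ℕ → ℂ := fun h => psiCoeff (1 / √(N : ℝ)) h * expCirc (h * y) with hc
  set F : ℕ → ℂ := fun b => ∑ h ∈ Ico K (2 * K), ∑ a ∈ A,
    c h * expCirc (h * √(a : ℝ) * √(b : ℝ)) with hF
  have hsum : ∑ h ∈ Ico K (2 * K), ∑ a ∈ A, ∑ b ∈ B,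
      (psiCoeff (1 / √(N : ℝ)) h * expCirc (h * (√(a * b : ℝ) + y))).re =
      (∑ b ∈ B, F b).re := by
    have hterm (h a b : ℕ) : psiCoeff (1 / √(N : ℝ)) h * expCirc (h * (√(a * b : ℝ) + y)) =
        c h * expCirc (h * √(a : ℝ) * √(b : ℝ)) := by
      simp only [hc]
      rw [Real.sqrt_mul (Nat.cast_nonneg a), mul_add, expCirc_add, ← mul_assoc (h : ℝ)]
      ring
    simp_rw [hterm]
    simp only [hF, Complex.re_sum]
    rw [sum_congr rfl fun h _ => sum_comm, sum_comm]
  have hlog : 1 ≤ log N := by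
    rw [Real.le_log_iff_exp_le hN0]
    linarith [Real.exp_one_lt_d9]
  have hL : 1 + log (8 * (K : ℝ) ^ 2 * N) ≤ 5 * log N := by
    have h1 : log (8 * (K : ℝ) ^ 2 * N) ≤ log ((N : ℝ) ^ 4) := by
      refine Real.log_le_log (by positivity) ?_
      calc 8 * (K : ℝ) ^ 2 * N ≤ N * (N : ℝ) ^ 2 * N := by gcongr
        _ = _ := by ring
    rw [Real.log_pow] at h1
    push_cast at h1
    linarith
  have hL0 : 0 ≤ 1 + log (8 * (K : ℝ) ^ 2 * N) := by
    have hK1 : (1 : ℝ) ≤ K := by exact_mod_cast hK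
    have h1 := one_le_mul_of_one_le_of_one_le (one_le_pow₀ hK1 (n := 2))
      (by linarith : (1 : ℝ) ≤ N)
    have h2 : 0 ≤ log (8 * (K : ℝ) ^ 2 * N) := log_nonneg (by linarith)
    linarith
  obtain ⟨M, hM, hMle⟩ : ∃ M : ℝ, (∀ h ∈ Ico K (2 * K), ‖c h‖ ≤ M) ∧
      (K : ℝ) ^ 2 * N * (N + (K : ℝ) ^ 2) * M ^ 2 ≤ 2 * (N : ℝ) ^ 2 := by
    have hnorm (h : ℕ) : ‖c h‖ = ‖psiCoeff (1 / √(N : ℝ)) h‖ := by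
      rw [hc, norm_mul, norm_expCirc, mul_one]
    have hKh : ∀ h ∈ Ico K (2 * K), (K : ℝ) ≤ h := fun h hh => by
      exact_mod_cast (mem_Ico.1 hh).1
    rcases le_total ((K : ℝ) ^ 2) N with h | h
    · refine ⟨1 / K, fun k hk => ?_, ?_⟩
      · rw [hnorm]
        refine (norm_psiCoeff_le_inv hδ k).trans ?_
        have := hKh k hk
        gcongr
      · field_simp
        nlinarith
    · refine ⟨1 / (1 / √(N : ℝ) * (K : ℝ) ^ 2), fun k hk => ?_, ?_⟩
      · rw [hnorm]
        refine (norm_psiCoeff_le_inv_sq hδ k).trans ?_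
        have := hKh k hk
        gcongr
      · have : (1 / (1 / √(N : ℝ) * (K : ℝ) ^ 2)) ^ 2 = N / (K : ℝ) ^ 4 := by
          rw [one_div_mul_eq_div, one_div_div, div_pow, Real.sq_sqrt hN0.le]
          ring
        rw [this]
        field_simp
        nlinarith
  have hblock : ∑ b ∈ B, ‖F b‖ ^ 2 ≤ 44800 * (N : ℝ) ^ 2 * log N := by
    calc _ ≤ ∑ b ∈ Ioc N (2 * N), ‖F b‖ ^ 2 :=
          sum_le_sum_of_subset_of_nonneg hB fun _ _ _ => sq_nonneg _
      _ ≤ _ := sum_norm_sq_block_le hK (by omega) hA hM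
      _ = 4480 * ((K : ℝ) ^ 2 * N * (N + (K : ℝ) ^ 2) * M ^ 2) *
            (1 + log (8 * (K : ℝ) ^ 2 * N)) := by ring
      _ ≤ 4480 * (2 * (N : ℝ) ^ 2) * (5 * log N) := by gcongr
      _ = _ := by ring
  rw [hsum]
  refine (Complex.abs_re_le_norm _).trans ((norm_sum_le _ _).trans ?_)
  refine le_of_sq_le_sq ?_ (by positivity)
  refine (sq_sum_le_card_mul_sum_sq (s := B) (f := fun b => ‖F b‖)).trans ?_
  calc _ ≤ #B * (44800 * (N : ℝ) ^ 2 * log N) := by gcongr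
    _ ≤ #B * (213 ^ 2 * (N : ℝ) ^ 2 * log N) := by
        gcongr
        norm_num
    _ = _ := by
        rw [mul_pow, mul_pow, mul_pow, Real.sq_sqrt (by positivity), Real.sq_sqrt (by linarith)]
        ring

lemma abs_sum_psiPrim_diff_le {N : ℕ} (hN : 8 ≤ N) {A B : Finset ℕ}
    (hA : A ⊆ Ioc N (2 * N)) (hB : B ⊆ Ioc N (2 * N)) (y : ℝ) :
    |∑ a ∈ A, ∑ b ∈ B, (psiPrim (√(a * b : ℝ) + y + 1 / √(N : ℝ)) - psiPrim (√(a * b : ℝ) + y)) /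
      (1 / √(N : ℝ))| ≤
      639 * √(#B : ℝ) * N * (√(log N) * log N) + 2 * (#A * #B / √(N : ℝ)) := by
  have hN8 : (8 : ℝ) ≤ N := by exact_mod_cast hN
  have hN0 : (0 : ℝ) < N := by linarith
  have hs : 0 < √(N : ℝ) := Real.sqrt_pos.2 hN0
  have hlog : 1 ≤ log N := by
    rw [Real.le_log_iff_exp_le hN0]
    linarith [Real.exp_one_lt_d9]
  set δ := 1 / √(N : ℝ) with hδdef
  have hδ : 0 < δ := by positivity
  set J := Nat.log 2 N + 1 with hJ
  set D : ℝ → ℝ := fun x => (psiPrim (x + δ) - psiPrim x) / δ with hD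
  set P : ℝ → ℝ := fun x => ∑ h ∈ range (2 ^ J), (psiCoeff δ h * expCirc (h * x)).re with hP
  have hNJ : (N : ℝ) ≤ (2 ^ J : ℕ) := by
    exact_mod_cast (Nat.lt_pow_succ_log_self (by norm_num) N).le
  have hDP (x : ℝ) : |D x - P x| ≤ 2 / √(N : ℝ) := by
    refine (abs_psiPrim_diff_sub_sum_le hδ x (by positivity)).trans ?_
    calc _ ≤ 2 / (δ * N) := by gcongr
      _ = _ := by
        have h1 := Real.sq_sqrt hN0.le
        rw [hδdef]
        field_simp
        linarith
  have hJle : (J : ℝ) ≤ 3 * log N := by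
    have h1 : ((2 ^ Nat.log 2 N : ℕ) : ℝ) ≤ N := by
      exact_mod_cast Nat.pow_log_le_self 2 (by omega)
    have h2 := Real.log_le_log (by positivity) h1
    push_cast at h2
    rw [Real.log_pow] at h2
    rw [hJ]
    push_cast
    nlinarith [Real.log_two_gt_d9, Nat.cast_nonneg (α := ℝ) (Nat.log 2 N)]
  have hPsum : |∑ a ∈ A, ∑ b ∈ B, P (√(a * b : ℝ) + y)| ≤
      639 * √(#B : ℝ) * N * (√(log N) * log N) := by
    set g : ℕ → ℝ := fun h => ∑ a ∈ A, ∑ b ∈ B,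
      (psiCoeff δ h * expCirc (h * (√(a * b : ℝ) + y))).re with hg
    have hswap : ∑ a ∈ A, ∑ b ∈ B, P (√(a * b : ℝ) + y) = ∑ h ∈ range (2 ^ J), g h := by
      simp only [hP, hg]
      rw [sum_comm (s := range (2 ^ J))]
      exact sum_congr rfl fun a _ => sum_comm
    have hg0 : g 0 = 0 := by simp [hg, psiCoeff]
    rw [hswap]
    refine (abs_sum_range_two_pow_le g hg0 J).trans ?_
    calc _ ≤ ∑ j ∈ range J, 213 * √(#B : ℝ) * N * √(log N) := by
          refine sum_le_sum fun j hj => ?_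
          have hjN : 2 ^ j ≤ N := by
            refine le_trans (Nat.pow_le_pow_right (by norm_num) ?_)
              (Nat.pow_log_le_self 2 (by omega : N ≠ 0))
            have := mem_range.1 hj
            omega
          exact abs_block_sum_le hN (by positivity) hjN hA hB y
      _ = J * (213 * √(#B : ℝ) * N * √(log N)) := by rw [sum_const, card_range, nsmul_eq_mul]
      _ ≤ 3 * log N * (213 * √(#B : ℝ) * N * √(log N)) := by gcongr
      _ = _ := by ring
  have herr : |∑ a ∈ A, ∑ b ∈ B, (D (√(a * b : ℝ) + y) - P (√(a * b : ℝ) + y))| ≤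
      2 * (#A * #B / √(N : ℝ)) := by
    calc _ ≤ ∑ a ∈ A, ∑ b ∈ B, 2 / √(N : ℝ) :=
          (abs_sum_le_sum_abs _ _).trans (sum_le_sum fun a _ =>
            (abs_sum_le_sum_abs _ _).trans (sum_le_sum fun b _ => hDP _))
      _ = _ := by
          simp only [sum_const, nsmul_eq_mul]
          ring
  have hsplit : ∑ a ∈ A, ∑ b ∈ B, D (√(a * b : ℝ) + y) =
      ∑ a ∈ A, ∑ b ∈ B, P (√(a * b : ℝ) + y) +
      ∑ a ∈ A, ∑ b ∈ B, (D (√(a * b : ℝ) + y) - P (√(a * b : ℝ) + y)) := by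
    simp only [sum_sub_distrib]
    ring
  change |∑ a ∈ A, ∑ b ∈ B, D (√(a * b : ℝ) + y)| ≤ _
  rw [hsplit]
  exact (abs_add_le _ _).trans (add_le_add hPsum herr)

lemma abs_sum_psiSaw_le {N : ℕ} (hN : 8 ≤ N) {A B : Finset ℕ}
    (hA : A ⊆ Ioc N (2 * N)) (hB : B ⊆ Ioc N (2 * N)) (y : ℝ) :
    |∑ a ∈ A, ∑ b ∈ B, psiSaw (√(a * b : ℝ) + y)| ≤
      639 * √(#B : ℝ) * N * (√(log N) * log N) + 5 / 2 * (#A * #B / √(N : ℝ)) := by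
  have hN0 : (0 : ℝ) < N := by exact_mod_cast (by omega : 0 < N)
  have hs : 0 < √(N : ℝ) := Real.sqrt_pos.2 hN0
  have hup := abs_sum_psiPrim_diff_le hN hA hB (y - 1 / √(N : ℝ))
  have hlo := abs_sum_psiPrim_diff_le hN hA hB y
  set δ := 1 / √(N : ℝ) with hδdef
  have hδ : 0 < δ := by positivity
  have hconst : ∑ a ∈ A, ∑ b ∈ B, δ / 2 = 1 / 2 * (#A * #B / √(N : ℝ)) := by
    simp only [sum_const, nsmul_eq_mul, hδdef]
    ring
  rw [abs_le]
  constructor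
  · have h1 : ∑ a ∈ A, ∑ b ∈ B,
        ((psiPrim (√(a * b : ℝ) + y + δ) - psiPrim (√(a * b : ℝ) + y)) / δ - δ / 2) ≤
        ∑ a ∈ A, ∑ b ∈ B, psiSaw (√(a * b : ℝ) + y) := by
      refine sum_le_sum fun a _ => sum_le_sum fun b _ => ?_
      rw [sub_le_iff_le_add, div_le_iff₀ hδ]
      exact (psiPrim_sub_le _ hδ.le).trans (le_of_eq (by ring))
    simp only [sum_sub_distrib, hconst] at h1
    linarith [(abs_le.1 hlo).1]
  · have h1 : ∑ a ∈ A, ∑ b ∈ B, psiSaw (√(a * b : ℝ) + y) ≤ ∑ a ∈ A, ∑ b ∈ B,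
        ((psiPrim (√(a * b : ℝ) + (y - δ) + δ) - psiPrim (√(a * b : ℝ) + (y - δ))) / δ +
          δ / 2) := by
      refine sum_le_sum fun a _ => sum_le_sum fun b _ => ?_
      rw [← sub_le_iff_le_add, le_div_iff₀ hδ]
      have := le_psiPrim_sub (√(a * b : ℝ) + (y - δ)) hδ.le
      rw [show √(a * b : ℝ) + (y - δ) + δ = √(a * b : ℝ) + y by ring] at this ⊢
      exact le_trans (le_of_eq (by ring)) this
    simp only [sum_add_distrib, hconst] at h1
    linarith [(abs_le.1 hup).2]

lemma abs_sum_psiSaw_le_of_card_le {N : ℕ} (hN : 8 ≤ N) {A B : Finset ℕ}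
    (hA : A ⊆ Ioc N (2 * N)) (hB : B ⊆ Ioc N (2 * N)) (hBA : #B ≤ #A) (y : ℝ) :
    |∑ a ∈ A, ∑ b ∈ B, psiSaw (√(a * b : ℝ) + y)| ≤
      1000 * N * ((#A : ℝ) * #B) ^ ((1 : ℝ) / 4) * (log N) ^ ((3 : ℝ) / 2) := by
  have hN8 : (8 : ℝ) ≤ N := by exact_mod_cast hN
  have hN0 : (0 : ℝ) < N := by linarith
  have hs : 0 < √(N : ℝ) := Real.sqrt_pos.2 hN0
  have hlog : 1 ≤ log N := by
    rw [Real.le_log_iff_exp_le hN0]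
    linarith [Real.exp_one_lt_d9]
  have hcard {S : Finset ℕ} (hS : S ⊆ Ioc N (2 * N)) : (#S : ℝ) ≤ N := by
    have := card_le_card hS
    rw [Nat.card_Ioc] at this
    exact_mod_cast (by omega : #S ≤ N)
  set X : ℝ := (#A : ℝ) * #B with hX
  have hX0 : 0 ≤ X := by positivity
  have hBA' : (#B : ℝ) ≤ #A := by exact_mod_cast hBA
  have hsqrtB : √(#B : ℝ) ≤ X ^ ((1 : ℝ) / 4) := by
    have h1 : √(#B : ℝ) = ((#B : ℝ) * #B) ^ ((1 : ℝ) / 4) := by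
      rw [← sq, ← Real.rpow_natCast, ← Real.rpow_mul (by positivity), Real.sqrt_eq_rpow]
      norm_num
    rw [h1]
    exact Real.rpow_le_rpow (by positivity)
      (mul_le_mul_of_nonneg_right hBA' (by positivity)) (by norm_num)
  have hXN : X / √(N : ℝ) ≤ X ^ ((1 : ℝ) / 4) * N := by
    have h1 : X ≤ (N : ℝ) ^ 2 := by
      rw [sq]
      exact mul_le_mul (hcard hA) (hcard hB) (by positivity) (by positivity)
    have h2 : X = X ^ ((1 : ℝ) / 4) * X ^ ((3 : ℝ) / 4) := by
      rw [← Real.rpow_add_of_nonneg hX0 (by norm_num) (by norm_num)]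
      norm_num
    have h3 : X ^ ((3 : ℝ) / 4) ≤ N * √(N : ℝ) := by
      refine (Real.rpow_le_rpow hX0 h1 (by norm_num)).trans (le_of_eq ?_)
      rw [← Real.rpow_natCast, ← Real.rpow_mul hN0.le, Real.sqrt_eq_rpow]
      nth_rewrite 2 [← Real.rpow_one (N : ℝ)]
      rw [← Real.rpow_add hN0]
      norm_num
    rw [div_le_iff₀ hs, mul_assoc]
    calc X = X ^ ((1 : ℝ) / 4) * X ^ ((3 : ℝ) / 4) := h2
      _ ≤ X ^ ((1 : ℝ) / 4) * (N * √(N : ℝ)) :=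
        mul_le_mul_of_nonneg_left h3 (Real.rpow_nonneg hX0 _)
  have hlogpow : √(log N) * log N = (log N) ^ ((3 : ℝ) / 2) := by
    rw [Real.sqrt_eq_rpow, ← Real.rpow_add_one (by linarith)]
    norm_num
  have hlogpow1 : 1 ≤ (log N) ^ ((3 : ℝ) / 2) := Real.one_le_rpow hlog (by norm_num)
  refine (abs_sum_psiSaw_le hN hA hB y).trans ?_
  rw [hlogpow]
  have hXL : X ^ ((1 : ℝ) / 4) * N ≤ X ^ ((1 : ℝ) / 4) * N * (log N) ^ ((3 : ℝ) / 2) :=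
    le_mul_of_one_le_right (by positivity) hlogpow1
  calc _ ≤ 639 * X ^ ((1 : ℝ) / 4) * N * (log N) ^ ((3 : ℝ) / 2) +
        5 / 2 * (X ^ ((1 : ℝ) / 4) * N * (log N) ^ ((3 : ℝ) / 2)) := by
        gcongr
        exact hXN.trans hXL
    _ ≤ _ := by
        have : 0 ≤ X ^ ((1 : ℝ) / 4) * N * (log N) ^ ((3 : ℝ) / 2) := by positivity
        linarith

/-- **Estimate (3.13).** For any sign `σ ∈ {+1, −1}`,
`|Σ_{a∈𝔄} Σ_{b∈𝔅} ψ(√(ab) + σΔ)| ≪ N (|𝔄||𝔅|)^{1/4} (log N)^{3/2}`. -/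
theorem psi_double_sum_bound :
    ∀ ε : ℝ, 0 < ε → ∃ C : ℝ, 0 < C ∧ ∃ N₀ : ℕ, ∀ N : ℕ, N₀ ≤ N →
      ∀ A B : Finset ℕ, A ⊆ Finset.Icc (N + 1) (2 * N) → B ⊆ Finset.Icc (N + 1) (2 * N) →
        (N : ℝ) ^ ((4 : ℝ) / 3 + ε) ≤ (A.card : ℝ) * B.card →
        ∀ Δ : ℝ, 0 < Δ → Δ ≤ 1 / 2 →
          ∀ σ : ℝ, σ = 1 ∨ σ = -1 →
            |∑ a ∈ A, ∑ b ∈ B, psiSaw (Real.sqrt (a * b) + σ * Δ)| ≤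
              C * N * ((A.card : ℝ) * B.card) ^ ((1 : ℝ) / 4) *
                (Real.log N) ^ ((3 : ℝ) / 2) := by
  have hI (N : ℕ) : Icc (N + 1) (2 * N) = Ioc N (2 * N) := by
    ext k
    simp only [mem_Icc, mem_Ioc]
    omega
  intro ε _
  refine ⟨1000, by norm_num, 8, fun N hN A B hA hB _ Δ _ _ σ _ => ?_⟩
  rw [hI] at hA hB
  rcases le_total #B #A with h | h
  · exact abs_sum_psiSaw_le_of_card_le hN hA hB h (σ * Δ)
  · have := abs_sum_psiSaw_le_of_card_le hN hB hA h (σ * Δ)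
    rw [sum_comm, mul_comm (#A : ℝ)]
    simpa only [mul_comm] using this
end

section
/- There exists a constant C > 0 such that for all natural numbers N ≥ 2, all 𝔄, 𝔅 ⊆ {N+1, …, 2N}, all integers d ≥ 1, all reals H₁ ≥ 1, and all complex numbers c(h) with |c(h)| ≤ 1 for H₁ < h ≤ 2H₁, one has |Σ_{H₁ < h ≤ 2H₁} c(h) Σ_{a∈𝔄} Σ_{b∈𝔅} e(h√(ab)/d)| ≤ C · N · H₁ · (|𝔄||𝔅|)^{1/4} · (1 + d^{1/2}H₁^{−1/2}) · (log(2NH₁))^{1/2}. -/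
/-- `e(t) = e^{2πit}`. -/
noncomputable def eTwoPi (t : ℝ) : ℂ := Complex.exp (2 * Real.pi * Complex.I * t)

/-- Fractions with numerator and denominator of a fixed gcd `g` and denominator at most `Q`
are spaced by `(g / Q) ^ 2`, so few of them lie in a short interval. -/
theorem card_pairs_gcd_le {Q : ℝ} {η τ : ℝ} {g : ℕ} (hg : 0 < g) (S : Finset (ℕ × ℕ))
    (hgcd : ∀ x ∈ S, x.1.gcd x.2 = g) (hpos : ∀ x ∈ S, 0 < x.2) (hQ : ∀ x ∈ S, (x.2 : ℝ) ≤ Q)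
    (hη : 0 ≤ η) (hnear : ∀ x ∈ S, |(x.1 : ℝ) / x.2 - τ| ≤ η) :
    (S.card : ℝ) ≤ 1 + 2 * η * (Q / g) ^ 2 := by
  classical
  rcases S.eq_empty_or_nonempty with rfl | ⟨x₀, hx₀⟩
  · simp; positivity
  have hg' : (0 : ℝ) < g := by exact_mod_cast hg
  have hQ0 : 0 < Q := lt_of_lt_of_le (by exact_mod_cast hpos x₀ hx₀) (hQ x₀ hx₀)
  set W : ℝ := (Q / g) ^ 2 with hW
  have hW0 : 0 < W := by positivity
  have inj : Set.InjOn (fun x : ℕ × ℕ => ⌊((x.1 : ℝ) / x.2 - (τ - η)) * W⌋₊) S := by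
    rintro ⟨p, q⟩ hx ⟨p', q'⟩ hy hxy
    have hx : (p, q) ∈ S := hx
    have hy : (p', q') ∈ S := hy
    simp only at hxy
    have q0 : 0 < q := hpos _ hx
    have q0' : 0 < q' := hpos _ hy
    have e1 := hgcd _ hx
    have e2 := hgcd _ hy
    simp only at e1 e2
    have n1 := abs_le.mp (hnear _ hx)
    have n2 := abs_le.mp (hnear _ hy)
    simp only at n1 n2
    have l1 : |((p : ℝ) / q - (τ - η)) * W - ((p' : ℝ) / q' - (τ - η)) * W| < 1 := by
      have f1 := Nat.floor_le (mul_nonneg (by linarith : 0 ≤ (p : ℝ) / q - (τ - η)) hW0.le)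
      have f2 := Nat.floor_le (mul_nonneg (by linarith : 0 ≤ (p' : ℝ) / q' - (τ - η)) hW0.le)
      have f3 := Nat.lt_floor_add_one (((p : ℝ) / q - (τ - η)) * W)
      have f4 := Nat.lt_floor_add_one (((p' : ℝ) / q' - (τ - η)) * W)
      rw [hxy] at f1 f3
      rw [abs_lt]
      constructor <;> linarith
    obtain ⟨m, n, hmn, rfl, rfl⟩ : ∃ m n, Nat.Coprime m n ∧ p = m * g ∧ q = n * g := by
      obtain ⟨m, n, h, h1, h2⟩ := Nat.exists_coprime p q
      exact ⟨m, n, h, by rwa [e1] at h1, by rwa [e1] at h2⟩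
    obtain ⟨m', n', hmn', rfl, rfl⟩ : ∃ m n, Nat.Coprime m n ∧ p' = m * g ∧ q' = n * g := by
      obtain ⟨m, n, h, h1, h2⟩ := Nat.exists_coprime p' q'
      exact ⟨m, n, h, by rwa [e2] at h1, by rwa [e2] at h2⟩
    have b1 := hQ _ hx
    have b2 := hQ _ hy
    push_cast at b1 b2
    have n0 : 0 < n := Nat.pos_of_mul_pos_right q0
    have n0' : 0 < n' := Nat.pos_of_mul_pos_right q0'
    have N0 : (0 : ℝ) < n := by exact_mod_cast n0
    have N0' : (0 : ℝ) < n' := by exact_mod_cast n0'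
    have c1 : (n : ℝ) ≤ Q / g := by rwa [le_div_iff₀ hg']
    have c2 : (n' : ℝ) ≤ Q / g := by rwa [le_div_iff₀ hg']
    have c3 : (n : ℝ) * n' ≤ W := by
      rw [hW, sq]; gcongr
    have key : ((m * n' : ℕ) : ℤ) - ((m' * n : ℕ) : ℤ) = 0 := by
      rw [← Int.abs_lt_one_iff]
      have : |((m : ℝ) * n' - m' * n)| < 1 := by
        have : ((m * g : ℕ) : ℝ) / (n * g : ℕ) - (m' * g : ℕ) / (n' * g : ℕ)
            = (m * n' - m' * n) / (n * n') := by
          push_cast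
          field_simp
        rw [← sub_mul, sub_sub_sub_cancel_right, this, abs_mul, abs_of_pos hW0, abs_div,
          abs_of_pos (mul_pos N0 N0'), div_mul_eq_mul_div, div_lt_one (by positivity)] at l1
        by_contra! hc
        nlinarith
      exact_mod_cast this
    have key : m * n' = m' * n := by omega
    have d1 : n ∣ n' := hmn.symm.dvd_of_dvd_mul_left (key ▸ Dvd.intro_left _ rfl)
    have d2 : n' ∣ n := hmn'.symm.dvd_of_dvd_mul_left (key ▸ Dvd.intro_left _ rfl)
    have : n = n' := Nat.dvd_antisymm d1 d2
    subst this
    have : m = m' := Nat.eq_of_mul_eq_mul_right n0 key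
    rw [this]
  have hsub : S.image (fun x : ℕ × ℕ => ⌊((x.1 : ℝ) / x.2 - (τ - η)) * W⌋₊)
      ⊆ Finset.range (⌊2 * η * W⌋₊ + 1) := by
    intro k hk
    obtain ⟨x, hx, rfl⟩ := Finset.mem_image.mp hk
    rw [Finset.mem_range, Nat.lt_succ_iff]
    apply Nat.floor_mono
    have := (abs_le.mp (hnear x hx)).2
    gcongr
    linarith
  have := Finset.card_le_card hsub
  rw [Finset.card_image_of_injOn inj, Finset.card_range] at this
  calc (S.card : ℝ) ≤ ((⌊2 * η * W⌋₊ + 1 : ℕ) : ℝ) := by exact_mod_cast this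
    _ ≤ _ := by
      push_cast
      linarith [Nat.floor_le (show 0 ≤ 2 * η * W by positivity)]

theorem card_image_pairs_gcd_le {Q : ℝ} (hQ0 : 0 ≤ Q) {g : ℕ} (S : Finset (ℕ × ℕ))
    (hgcd : ∀ x ∈ S, x.1.gcd x.2 = g) (hpos : ∀ x ∈ S, 0 < x.1 ∧ 0 < x.2)
    (hQ : ∀ x ∈ S, (x.1 : ℝ) ≤ Q ∧ (x.2 : ℝ) ≤ Q) :
    (S.card : ℝ) ≤ (Q / g) ^ 2 := by
  classical
  set D := (Finset.Ioc 0 ⌊Q⌋₊).filter (g ∣ ·) with hD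
  have hsub : S ⊆ D ×ˢ D := by
    intro x hx
    simp only [hD, Finset.mem_product, Finset.mem_filter, Finset.mem_Ioc]
    have h1 := hpos x hx
    have h2 := hQ x hx
    rw [← hgcd x hx]
    exact ⟨⟨⟨h1.1, Nat.le_floor h2.1⟩, Nat.gcd_dvd_left _ _⟩,
      ⟨⟨h1.2, Nat.le_floor h2.2⟩, Nat.gcd_dvd_right _ _⟩⟩
  have hc : (D.card : ℝ) ≤ Q / g := by
    rw [hD, Nat.Ioc_filter_dvd_card_eq_div]
    refine Nat.cast_div_le.trans ?_
    gcongr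
    exact Nat.floor_le hQ0
  calc (S.card : ℝ) ≤ ((D ×ˢ D).card : ℝ) := by exact_mod_cast Finset.card_le_card hsub
    _ = (D.card : ℝ) ^ 2 := by rw [Finset.card_product]; push_cast; ring
    _ ≤ _ := by gcongr

theorem abs_ratio_sub_le {H N K h₁ h₂ a₁ a₂ : ℝ} (hH : 0 < H) (hN : 0 < N)
    (h1 : H ≤ h₁) (h2 : H ≤ h₂) (h2' : h₂ ≤ 2 * H) (k1 : N ≤ a₁) (k1' : a₁ ≤ 2 * N) (k2 : N ≤ a₂)
    (hK : |h₁ ^ 2 * a₁ - h₂ ^ 2 * a₂| ≤ K) :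
    |h₁ / h₂ - √(a₂ / a₁)| ≤ K / (H ^ 2 * N) ∧ |a₂ / a₁ - (h₁ / h₂) ^ 2| ≤ K / (H ^ 2 * N) := by
  have p1 : 0 < h₁ := by linarith
  have p2 : 0 < h₂ := by linarith
  have q1 : 0 < a₁ := by linarith
  have q2 : 0 < a₂ := by linarith
  have hK0 : 0 ≤ K := (abs_nonneg _).trans hK
  have main : |a₂ / a₁ - (h₁ / h₂) ^ 2| ≤ K / (H ^ 2 * N) := by
    have : a₂ / a₁ - (h₁ / h₂) ^ 2 = -(h₁ ^ 2 * a₁ - h₂ ^ 2 * a₂) / (h₂ ^ 2 * a₁) := by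
      field_simp; ring
    rw [this, abs_div, abs_neg, abs_of_pos (by positivity : 0 < h₂ ^ 2 * a₁)]
    gcongr
  refine ⟨?_, main⟩
  have t1 : 1 / 2 ≤ h₁ / h₂ := by
    rw [div_le_div_iff₀ (by norm_num) p2]; linarith
  have t2 : 1 / 2 ≤ √(a₂ / a₁) := by
    apply Real.le_sqrt_of_sq_le
    rw [le_div_iff₀ q1]; linarith
  have t3 : a₂ / a₁ = √(a₂ / a₁) ^ 2 := (Real.sq_sqrt (by positivity)).symm
  rw [abs_sub_comm, t3, sq_sub_sq, abs_mul, abs_of_pos (by linarith)] at main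
  refine le_trans ?_ main
  nlinarith [abs_nonneg (h₁ / h₂ - √(a₂ / a₁))]

/-- A finite set is bounded by (number of fibers) times (size of a fiber). -/
theorem card_le_of_fibers {α β : Type*} [DecidableEq β] (U : Finset α) (f : α → β) {D B : ℝ}
    (hB0 : 0 ≤ B) (hD : ((U.image f).card : ℝ) ≤ D)
    (hB : ∀ b ∈ U.image f, ((U.filter (f · = b)).card : ℝ) ≤ B) : (U.card : ℝ) ≤ D * B := by
  rw [Finset.card_eq_sum_card_image f U]
  push_cast
  calc ∑ b ∈ U.image f, ((U.filter (f · = b)).card : ℝ) ≤ ∑ b ∈ U.image f, B :=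
        Finset.sum_le_sum hB
    _ = (U.image f).card * B := by rw [Finset.sum_const, nsmul_eq_mul]
    _ ≤ D * B := by gcongr

/-- Solutions of `|h₁² a₁ - h₂² a₂| ≤ K` with prescribed `gcd(h₁, h₂)` and `gcd(a₁, a₂)`. -/
theorem card_quadruples_gcd_le {H N K : ℝ} (hH : 0 < H) (hN : 0 < N) (hK0 : 0 ≤ K) {g r : ℕ}
    (hg : 0 < g) (hr : 0 < r) (U : Finset ((ℕ × ℕ) × (ℕ × ℕ)))
    (h1 : ∀ x ∈ U, H ≤ x.1.1 ∧ (x.1.1 : ℝ) ≤ 2 * H) (h2 : ∀ x ∈ U, H ≤ x.2.1 ∧ (x.2.1 : ℝ) ≤ 2 * H)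
    (a1 : ∀ x ∈ U, N ≤ x.1.2 ∧ (x.1.2 : ℝ) ≤ 2 * N) (a2 : ∀ x ∈ U, N ≤ x.2.2 ∧ (x.2.2 : ℝ) ≤ 2 * N)
    (hgcd : ∀ x ∈ U, x.1.1.gcd x.2.1 = g) (rgcd : ∀ x ∈ U, x.1.2.gcd x.2.2 = r)
    (hK : ∀ x ∈ U, |(x.1.1 : ℝ) ^ 2 * x.1.2 - (x.2.1 : ℝ) ^ 2 * x.2.2| ≤ K) :
    (U.card : ℝ) ≤ 4 * min ((H / g) ^ 2) ((N / r) ^ 2) + 32 * K * N / (g * r) ^ 2 := by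
  classical
  have g0 : (0 : ℝ) < g := by exact_mod_cast hg
  have r0 : (0 : ℝ) < r := by exact_mod_cast hr
  have pos : ∀ x ∈ U, (0 < x.1.1 ∧ 0 < x.1.2) ∧ (0 < x.2.1 ∧ 0 < x.2.2) := by
    intro x hx
    refine ⟨⟨?_, ?_⟩, ?_, ?_⟩
    · exact_mod_cast hH.trans_le (h1 x hx).1
    · exact_mod_cast hN.trans_le (a1 x hx).1
    · exact_mod_cast hH.trans_le (h2 x hx).1
    · exact_mod_cast hN.trans_le (a2 x hx).1
  have near := fun x hx => abs_ratio_sub_le hH hN (h1 x hx).1 (h2 x hx).1 (h2 x hx).2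
    (a1 x hx).1 (a1 x hx).2 (a2 x hx).1 (hK x hx)
  have boundA : (U.card : ℝ) ≤ (2 * N / r) ^ 2 *
      (1 + 2 * (K / (H ^ 2 * N)) * (2 * H / g) ^ 2) := by
    refine card_le_of_fibers U (fun x => (x.1.2, x.2.2)) (by positivity) ?_ ?_
    · apply card_image_pairs_gcd_le (by positivity)
      · simp only [Finset.forall_mem_image]
        exact rgcd
      · simp only [Finset.forall_mem_image]
        exact fun x hx => ⟨(pos x hx).1.2, (pos x hx).2.2⟩
      · simp only [Finset.forall_mem_image]
        exact fun x hx => ⟨(a1 x hx).2, (a2 x hx).2⟩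
    · rintro ⟨b₁, b₂⟩ -
      rw [← Finset.card_image_of_injOn (f := fun x : (ℕ × ℕ) × (ℕ × ℕ) => (x.1.1, x.2.1))]
      · apply card_pairs_gcd_le (τ := √((b₂ : ℝ) / b₁)) hg
        all_goals try simp only [Finset.forall_mem_image, Finset.mem_filter, Prod.mk.injEq]
        · exact fun x hx => hgcd x hx.1
        · exact fun x hx => (pos x hx.1).2.1
        · exact fun x hx => (h2 x hx.1).2
        · positivity
        · rintro x ⟨hx, rfl, rfl⟩
          exact (near x hx).1
      · rintro ⟨⟨_, _⟩, _, _⟩ hx ⟨⟨_, _⟩, _, _⟩ hy hxy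
        simp_all
  have boundB : (U.card : ℝ) ≤ (2 * H / g) ^ 2 *
      (1 + 2 * (K / (H ^ 2 * N)) * (2 * N / r) ^ 2) := by
    refine card_le_of_fibers U (fun x => (x.1.1, x.2.1)) (by positivity) ?_ ?_
    · apply card_image_pairs_gcd_le (by positivity)
      · simp only [Finset.forall_mem_image]
        exact hgcd
      · simp only [Finset.forall_mem_image]
        exact fun x hx => ⟨(pos x hx).1.1, (pos x hx).2.1⟩
      · simp only [Finset.forall_mem_image]
        exact fun x hx => ⟨(h1 x hx).2, (h2 x hx).2⟩
    · rintro ⟨b₁, b₂⟩ -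
      rw [← Finset.card_image_of_injOn (f := fun x : (ℕ × ℕ) × (ℕ × ℕ) => (x.2.2, x.1.2))]
      · apply card_pairs_gcd_le (τ := ((b₁ : ℝ) / b₂) ^ 2) hr
        all_goals try simp only [Finset.forall_mem_image, Finset.mem_filter, Prod.mk.injEq]
        · exact fun x hx => (Nat.gcd_comm _ _).trans (rgcd x hx.1)
        · exact fun x hx => (pos x hx.1).1.2
        · exact fun x hx => (a1 x hx.1).2
        · positivity
        · rintro x ⟨hx, rfl, rfl⟩
          exact (near x hx).2
      · rintro ⟨⟨_, _⟩, _, _⟩ hx ⟨⟨_, _⟩, _, _⟩ hy hxy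
        simp_all
  have eA : (2 * N / r) ^ 2 * (1 + 2 * (K / (H ^ 2 * N)) * (2 * H / g) ^ 2)
      = 4 * (N / r) ^ 2 + 32 * K * N / (g * r) ^ 2 := by
    field_simp; ring
  have eB : (2 * H / g) ^ 2 * (1 + 2 * (K / (H ^ 2 * N)) * (2 * N / r) ^ 2)
      = 4 * (H / g) ^ 2 + 32 * K * N / (g * r) ^ 2 := by
    field_simp; ring
  rcases min_cases ((H / g) ^ 2) ((N / r) ^ 2) with ⟨h, -⟩ | ⟨h, -⟩ <;> rw [h] <;> linarith

theorem sum_min_sq_le {A N : ℝ} (hA : 0 < A) (hN : 0 < N) (M : ℕ) :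
    ∑ r ∈ Finset.Icc 1 M, min (A ^ 2) ((N / r) ^ 2) ≤ 4 * A * N := by
  have key : ∀ M : ℕ, ∑ r ∈ Finset.Icc 1 M, min (A ^ 2) ((N / r) ^ 2)
      ≤ 4 * A * N - 4 * A * N * N / (N + A * M) := by
    intro M
    induction M with
    | zero => simp [hN.ne']
    | succ k ih =>
      rw [Finset.sum_Icc_succ_top (by omega)]
      have h : min (A ^ 2) ((N / (k + 1 : ℕ)) ^ 2)
          ≤ 4 * A * N * N / (N + A * k) - 4 * A * N * N / (N + A * (k + 1 : ℕ)) := by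
        have e : 4 * A * N * N / (N + A * k) - 4 * A * N * N / (N + A * (k + 1 : ℕ))
            = (2 * A * N) ^ 2 / ((N + A * k) * (N + A * (k + 1))) := by
          push_cast
          field_simp
          ring
        have e2 : (2 * A * N / (N + A * (k + 1))) ^ 2
            ≤ (2 * A * N) ^ 2 / ((N + A * k) * (N + A * (k + 1))) := by
          rw [div_pow]
          gcongr
          rw [sq]
          gcongr
          linarith
        rw [e]
        refine le_trans ?_ e2
        rcases le_total (A * (k + 1)) N with h | h
        · refine (min_le_left _ _).trans ?_
          gcongr
          rw [le_div_iff₀ (by positivity)]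
          nlinarith
        · refine (min_le_right _ _).trans ?_
          push_cast
          refine pow_le_pow_left₀ (by positivity) ?_ 2
          rw [div_le_div_iff₀ (by positivity) (by positivity)]
          nlinarith
      linarith
  have : 0 ≤ 4 * A * N * N / (N + A * M) := by positivity
  linarith [key M]

theorem sum_inv_sq_le_two (M : ℕ) : ∑ r ∈ Finset.Icc 1 M, 1 / (r : ℝ) ^ 2 ≤ 2 := by
  have key : ∀ M : ℕ, ∑ r ∈ Finset.Icc 1 M, 1 / (r : ℝ) ^ 2 ≤ 2 - 2 / ((M : ℝ) + 1) := by
    intro M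
    induction M with
    | zero => norm_num
    | succ k ih =>
      rw [Finset.sum_Icc_succ_top (by omega)]
      have : 1 / ((k + 1 : ℕ) : ℝ) ^ 2 ≤ 2 / ((k : ℝ) + 1) - 2 / (((k + 1 : ℕ) : ℝ) + 1) := by
        have e : 2 / ((k : ℝ) + 1) - 2 / (((k + 1 : ℕ) : ℝ) + 1) = 2 / ((k + 1) * (k + 2)) := by
          push_cast
          field_simp
          ring
        rw [e, div_le_div_iff₀ (by positivity) (by positivity)]
        push_cast
        nlinarith
      linarith
  linarith [key M, (by positivity : (0 : ℝ) ≤ 2 / ((M : ℝ) + 1))]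

theorem sum_inv_le_one_add_log {X : ℝ} (hX : 1 ≤ X) :
    ∑ g ∈ Finset.Icc 1 ⌊X⌋₊, 1 / (g : ℝ) ≤ 1 + Real.log X := by
  have h1 : 1 ≤ ⌊X⌋₊ := by rwa [Nat.one_le_floor_iff]
  have h := harmonic_le_one_add_log ⌊X⌋₊
  rw [harmonic_eq_sum_Icc] at h
  push_cast at h
  simp only [one_div]
  refine h.trans ?_
  gcongr
  exact Nat.floor_le (by linarith)

/-- The number of solutions of `|h₁² a₁ - h₂² a₂| ≤ K` in dyadic ranges. -/
theorem card_quadruples_le {H N K : ℝ} (hH : 1 ≤ H) (hN : 1 ≤ N) (hK0 : 0 ≤ K)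
    (U : Finset ((ℕ × ℕ) × (ℕ × ℕ)))
    (h1 : ∀ x ∈ U, H ≤ x.1.1 ∧ (x.1.1 : ℝ) ≤ 2 * H) (h2 : ∀ x ∈ U, H ≤ x.2.1 ∧ (x.2.1 : ℝ) ≤ 2 * H)
    (a1 : ∀ x ∈ U, N ≤ x.1.2 ∧ (x.1.2 : ℝ) ≤ 2 * N) (a2 : ∀ x ∈ U, N ≤ x.2.2 ∧ (x.2.2 : ℝ) ≤ 2 * N)
    (hK : ∀ x ∈ U, |(x.1.1 : ℝ) ^ 2 * x.1.2 - (x.2.1 : ℝ) ^ 2 * x.2.2| ≤ K) :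
    (U.card : ℝ) ≤ 16 * H * N * (1 + Real.log (2 * H)) + 128 * K * N := by
  classical
  have hH0 : 0 < H := by linarith
  have hN0 : 0 < N := by linarith
  have hmaps : Set.MapsTo
      (fun x : (ℕ × ℕ) × (ℕ × ℕ) => (x.1.1.gcd x.2.1, x.1.2.gcd x.2.2)) U
      (Finset.Icc 1 ⌊2 * H⌋₊ ×ˢ Finset.Icc 1 ⌊2 * N⌋₊ : Finset (ℕ × ℕ)) := by
    intro x hx
    have hx : x ∈ U := hx
    have p1 : 0 < x.1.1 := by exact_mod_cast hH0.trans_le (h1 x hx).1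
    have p2 : 0 < x.1.2 := by exact_mod_cast hN0.trans_le (a1 x hx).1
    rw [Finset.mem_coe, Finset.mem_product, Finset.mem_Icc, Finset.mem_Icc]
    exact ⟨⟨Nat.gcd_pos_of_pos_left _ p1,
        (Nat.le_of_dvd p1 (Nat.gcd_dvd_left _ _)).trans (Nat.le_floor (h1 x hx).2)⟩,
      Nat.gcd_pos_of_pos_left _ p2,
        (Nat.le_of_dvd p2 (Nat.gcd_dvd_left _ _)).trans (Nat.le_floor (a1 x hx).2)⟩
  rw [Finset.card_eq_sum_card_fiberwise hmaps, Finset.sum_product]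
  push_cast
  calc _ ≤ ∑ g ∈ Finset.Icc 1 ⌊2 * H⌋₊, ∑ r ∈ Finset.Icc 1 ⌊2 * N⌋₊,
        (4 * min ((H / g) ^ 2) ((N / r) ^ 2) + 32 * K * N / (g * r) ^ 2) := by
        refine Finset.sum_le_sum fun g hg => Finset.sum_le_sum fun r hr => ?_
        rw [Finset.mem_Icc] at hg hr
        apply card_quadruples_gcd_le hH0 hN0 hK0 hg.1 hr.1
        all_goals simp only [Finset.mem_filter, Prod.mk.injEq]
        · exact fun x hx => h1 x hx.1
        · exact fun x hx => h2 x hx.1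
        · exact fun x hx => a1 x hx.1
        · exact fun x hx => a2 x hx.1
        · exact fun x hx => hx.2.1
        · exact fun x hx => hx.2.2
        · exact fun x hx => hK x hx.1
    _ ≤ ∑ g ∈ Finset.Icc 1 ⌊2 * H⌋₊,
        (16 * H * N * (1 / (g : ℝ)) + 64 * K * N * (1 / (g : ℝ) ^ 2)) := by
        refine Finset.sum_le_sum fun g hg => ?_
        have g0 : (0 : ℝ) < g := by exact_mod_cast (Finset.mem_Icc.mp hg).1
        rw [Finset.sum_add_distrib, ← Finset.mul_sum]
        have e1 := sum_min_sq_le (show 0 < H / g by positivity) hN0 ⌊2 * N⌋₊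
        have e2 : ∑ r ∈ Finset.Icc 1 ⌊2 * N⌋₊, 32 * K * N / ((g : ℝ) * r) ^ 2
            = 32 * K * N * (1 / (g : ℝ) ^ 2) * ∑ r ∈ Finset.Icc 1 ⌊2 * N⌋₊, 1 / (r : ℝ) ^ 2 := by
          rw [Finset.mul_sum]
          refine Finset.sum_congr rfl fun r _ => ?_
          rw [mul_pow, mul_one_div, mul_one_div, div_div]
        rw [e2]
        have e3 : 32 * K * N * (1 / (g : ℝ) ^ 2) * ∑ r ∈ Finset.Icc 1 ⌊2 * N⌋₊, 1 / (r : ℝ) ^ 2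
            ≤ 32 * K * N * (1 / (g : ℝ) ^ 2) * 2 := by
          gcongr
          exact sum_inv_sq_le_two _
        have e4 : 4 * (H / g) * N = 4 * H * N * (1 / (g : ℝ)) := by ring
        linarith
    _ ≤ _ := by
        rw [Finset.sum_add_distrib, ← Finset.mul_sum, ← Finset.mul_sum]
        have e1 := sum_inv_le_one_add_log (show 1 ≤ 2 * H by linarith)
        have e2 := sum_inv_sq_le_two ⌊2 * H⌋₊
        have e3 : 16 * H * N * ∑ g ∈ Finset.Icc 1 ⌊2 * H⌋₊, 1 / (g : ℝ)
            ≤ 16 * H * N * (1 + Real.log (2 * H)) := by gcongr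
        have e4 : 64 * K * N * ∑ g ∈ Finset.Icc 1 ⌊2 * H⌋₊, 1 / (g : ℝ) ^ 2
            ≤ 64 * K * N * 2 := by gcongr
        linarith

theorem sum_two_pow_mul_le (M : ℕ) :
    ∑ j ∈ Finset.range M, (1 / 2 : ℝ) ^ j * (1 + j) ≤ 4 := by
  have key : ∀ M : ℕ, ∑ j ∈ Finset.range M, (1 / 2 : ℝ) ^ j * (1 + j)
      ≤ 4 - (1 / 2 : ℝ) ^ M * (4 + 2 * M) := by
    intro M
    induction M with
    | zero => norm_num
    | succ k ih =>
      rw [Finset.sum_range_succ, pow_succ]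
      push_cast
      linarith [pow_pos (show (0 : ℝ) < 1 / 2 by norm_num) k]
  linarith [key M, (by positivity : (0 : ℝ) ≤ (1 / 2 : ℝ) ^ M * (4 + 2 * M))]

/-- Summing a weight decaying like `2 ^ (-u)` against a linearly growing counting function. -/
theorem sum_two_pow_ceil_le {α : Type*} (U : Finset α) (u : α → ℝ) {R : ℝ}
    (hR : ∀ j : ℕ, ((U.filter (fun x => u x ≤ j)).card : ℝ) ≤ R * (1 + j)) :
    ∑ x ∈ U, (1 / 2 : ℝ) ^ ⌈u x⌉₊ ≤ 4 * R := by
  classical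
  have hR0 : 0 ≤ R := by
    have := (Nat.cast_nonneg _).trans (hR 0)
    simpa using this
  obtain ⟨M, hM⟩ : ∃ M, ∀ x ∈ U, ⌈u x⌉₊ ∈ Finset.range M := by
    refine ⟨U.sup (fun x => ⌈u x⌉₊) + 1, fun x hx => ?_⟩
    rw [Finset.mem_range, Nat.lt_succ_iff]
    exact Finset.le_sup (f := fun x => ⌈u x⌉₊) hx
  rw [← Finset.sum_fiberwise_of_maps_to hM]
  calc _ ≤ ∑ j ∈ Finset.range M, R * ((1 / 2 : ℝ) ^ j * (1 + j)) := by
        refine Finset.sum_le_sum fun j _ => ?_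
        have : ∑ x ∈ U with ⌈u x⌉₊ = j, (1 / 2 : ℝ) ^ ⌈u x⌉₊
            = (U.filter (fun x => ⌈u x⌉₊ = j)).card * (1 / 2 : ℝ) ^ j := by
          rw [← nsmul_eq_mul]
          exact Finset.sum_eq_card_nsmul fun x hx => by rw [(Finset.mem_filter.mp hx).2]
        rw [this]
        have : ((U.filter (fun x => ⌈u x⌉₊ = j)).card : ℝ) ≤ R * (1 + j) := by
          refine le_trans ?_ (hR j)
          exact_mod_cast Finset.card_le_card
            (Finset.monotone_filter_right _ fun x _ hx => by
              simpa [hx] using Nat.le_ceil (u x))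
        calc _ ≤ R * (1 + j) * (1 / 2 : ℝ) ^ j := by gcongr
          _ = _ := by ring
    _ ≤ _ := by
        rw [← Finset.mul_sum]
        nlinarith [sum_two_pow_mul_le M]

theorem exp_neg_sq_le_two_pow_ceil {u : ℝ} (hu : 0 ≤ u) :
    Real.exp (-(u ^ 2 / 4)) ≤ 2 * Real.exp 1 * (1 / 2 : ℝ) ^ ⌈u⌉₊ := by
  have h1 : Real.exp (-u) / 2 ≤ (1 / 2 : ℝ) ^ ⌈u⌉₊ := by
    have e : Real.exp (-u) ≤ (1 / 2 : ℝ) ^ u := by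
      rw [Real.rpow_def_of_pos (by norm_num), one_div, Real.log_inv]
      apply Real.exp_le_exp.mpr
      nlinarith [Real.log_two_lt_d9]
    have e2 : (1 / 2 : ℝ) ^ (u + 1) ≤ (1 / 2 : ℝ) ^ (⌈u⌉₊ : ℝ) :=
      Real.rpow_le_rpow_of_exponent_ge (by norm_num) (by norm_num) (Nat.ceil_lt_add_one hu).le
    rw [Real.rpow_natCast, Real.rpow_add (by norm_num), Real.rpow_one] at e2
    linarith
  have h2 : Real.exp (-(u ^ 2 / 4)) ≤ Real.exp 1 * Real.exp (-u) := by
    rw [← Real.exp_add]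
    apply Real.exp_le_exp.mpr
    nlinarith [sq_nonneg (u - 2)]
  have := mul_le_mul_of_nonneg_left h1 (Real.exp_pos 1).le
  linarith

theorem norm_eTwoPi (t : ℝ) : ‖eTwoPi t‖ = 1 := by
  rw [eTwoPi, show 2 * (Real.pi : ℂ) * Complex.I * t = ((2 * Real.pi * t : ℝ) : ℂ) * Complex.I by
    push_cast; ring, Complex.norm_exp_ofReal_mul_I]

theorem hasDerivAt_eTwoPi_mul (l v : ℝ) :
    HasDerivAt (fun v : ℝ => eTwoPi (l * v)) (2 * Real.pi * Complex.I * l * eTwoPi (l * v)) v := by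
  have e : (fun v : ℝ => eTwoPi (l * v))
      = fun v : ℝ => Complex.exp (2 * Real.pi * Complex.I * l * (v : ℂ)) := by
    funext v
    rw [eTwoPi]
    congr 1
    push_cast
    ring
  have h := (Complex.ofRealCLM.hasDerivAt (x := v)).const_mul (2 * (Real.pi : ℂ) * Complex.I * l)
  simp only [Complex.ofRealCLM_apply, Complex.ofReal_one, mul_one] at h
  rw [congrFun e v, e]
  exact h.cexp.congr_deriv (mul_comm _ _)

theorem eTwoPi_mul_conj (x y : ℝ) : eTwoPi x * (starRingEnd ℂ) (eTwoPi y) = eTwoPi (x - y) := by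
  unfold eTwoPi
  rw [← Complex.exp_conj, ← Complex.exp_add]
  congr 1
  simp only [map_mul, Complex.conj_ofReal, Complex.conj_I, map_ofNat]
  push_cast
  ring

theorem eTwoPi_mul_gaussian (T m v : ℝ) :
    eTwoPi (m * v) * Complex.exp (-(1 / T : ℝ) * (v : ℂ) ^ 2)
      = Complex.exp (Complex.I * (2 * Real.pi * m : ℝ) * v)
        * Complex.exp (-((1 / T : ℝ) : ℂ) * (v : ℂ) ^ 2) := by
  unfold eTwoPi
  congr 2
  push_cast
  ring

theorem integrable_eTwoPi_mul_gaussian {T : ℝ} (hT : 0 < T) (m : ℝ) :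
    MeasureTheory.Integrable
      (fun v : ℝ => eTwoPi (m * v) * Complex.exp (-(1 / T : ℝ) * (v : ℂ) ^ 2)) := by
  have hb : 0 < ((1 / T : ℝ) : ℂ).re := by rw [Complex.ofReal_re]; positivity
  refine (integrable_cexp_quadratic hb (Complex.I * (2 * Real.pi * m : ℝ)) 0).congr ?_
  refine Filter.Eventually.of_forall fun v => ?_
  simp only [eTwoPi_mul_gaussian]
  rw [← Complex.exp_add]
  congr 1
  rw [add_zero, add_comm]

theorem norm_integral_eTwoPi_mul_gaussian {T : ℝ} (hT : 0 < T) (m : ℝ) :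
    ‖∫ v : ℝ, eTwoPi (m * v) * Complex.exp (-(1 / T : ℝ) * (v : ℂ) ^ 2)‖
      = √(Real.pi * T) * Real.exp (-(Real.pi ^ 2 * T * m ^ 2)) := by
  have hb : 0 < ((1 / T : ℝ) : ℂ).re := by rw [Complex.ofReal_re]; positivity
  simp only [eTwoPi_mul_gaussian]
  rw [fourierIntegral_gaussian hb, norm_mul]
  congr 1
  · rw [show (Real.pi : ℂ) / ((1 / T : ℝ) : ℂ) = ((Real.pi * T : ℝ) : ℂ) by push_cast; field_simp,
      Complex.norm_cpow_eq_rpow_re_of_pos (by positivity), Real.sqrt_eq_rpow]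
    norm_num
  · rw [show -(((2 * Real.pi * m : ℝ) : ℂ)) ^ 2 / (4 * ((1 / T : ℝ) : ℂ))
        = ((-(Real.pi ^ 2 * T * m ^ 2) : ℝ) : ℂ) by push_cast; field_simp; ring,
      Complex.norm_exp_ofReal]

section trigSum

variable {ι : Type*} (s : Finset ι) (c : ι → ℂ) (l : ι → ℝ)

/-- The exponential sum `∑ c i * e(l i * v)`. -/
noncomputable def trigSum (v : ℝ) : ℂ := ∑ i ∈ s, c i * eTwoPi (l i * v)

theorem hasDerivAt_trigSum (v : ℝ) :
    HasDerivAt (trigSum s c l) (trigSum s (fun i => c i * (2 * Real.pi * Complex.I * l i)) l v) v := by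
  unfold trigSum
  refine HasDerivAt.fun_sum fun i _ => ?_
  exact ((hasDerivAt_eTwoPi_mul (l i) v).const_mul (c i)).congr_deriv (mul_assoc _ _ _).symm

theorem continuous_trigSum : Continuous (trigSum s c l) :=
  continuous_iff_continuousAt.mpr fun v => (hasDerivAt_trigSum s c l v).continuousAt

theorem norm_sq_trigSum_mul_gaussian (T v : ℝ) :
    ((‖trigSum s c l v‖ ^ 2 * Real.exp (-(1 / T) * v ^ 2) : ℝ) : ℂ)
      = ∑ i ∈ s, ∑ j ∈ s, c i * (starRingEnd ℂ) (c j) *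
        (eTwoPi ((l i - l j) * v) * Complex.exp (-(1 / T : ℝ) * (v : ℂ) ^ 2)) := by
  push_cast
  rw [← Complex.mul_conj', trigSum, map_sum, Finset.sum_mul_sum, Finset.sum_mul]
  refine Finset.sum_congr rfl fun i _ => ?_
  rw [Finset.sum_mul]
  refine Finset.sum_congr rfl fun j _ => ?_
  rw [sub_mul, ← eTwoPi_mul_conj, map_mul]
  ring

theorem integral_norm_sq_trigSum_le {T α β : ℝ} (hT : 0 < T) (hα : 0 ≤ α) (hαβ : α ≤ β)
    (hβ : β ^ 2 ≤ 3 * T) (hc : ∀ i ∈ s, ‖c i‖ ≤ 1) :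
    ∫ v in α..β, ‖trigSum s c l v‖ ^ 2 ≤ Real.exp 3 * (√(Real.pi * T) *
      ∑ i ∈ s, ∑ j ∈ s, Real.exp (-(Real.pi ^ 2 * T * (l i - l j) ^ 2))) := by
  set φ : ℝ → ℝ := fun v => ‖trigSum s c l v‖ ^ 2 * Real.exp (-(1 / T) * v ^ 2) with hφ
  have hint : MeasureTheory.Integrable (fun v => ((φ v : ℝ) : ℂ)) := by
    simp only [hφ, norm_sq_trigSum_mul_gaussian]
    exact MeasureTheory.integrable_finsetSum _ fun i _ =>
      MeasureTheory.integrable_finsetSum _ fun j _ =>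
        (integrable_eTwoPi_mul_gaussian hT _).const_mul _
  have hφint : MeasureTheory.Integrable φ := by simpa using hint.re
  have hφ0 : ∀ v, 0 ≤ φ v := fun v => by positivity
  have hcφ : Continuous φ := by
    have := continuous_trigSum s c l
    fun_prop
  have h1 : ∫ v in α..β, ‖trigSum s c l v‖ ^ 2 ≤ ∫ v in α..β, Real.exp 3 * φ v := by
    apply intervalIntegral.integral_mono_on hαβ
    · exact ((continuous_trigSum s c l).norm.pow 2).intervalIntegrable _ _
    · exact (hcφ.const_mul _).intervalIntegrable _ _
    · intro v hv
      have : 1 ≤ Real.exp 3 * Real.exp (-(1 / T) * v ^ 2) := by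
        rw [← Real.exp_add]
        apply Real.one_le_exp
        have : v ^ 2 ≤ 3 * T := (pow_le_pow_left₀ (hα.trans hv.1) hv.2 2).trans hβ
        have : v ^ 2 / T ≤ 3 := by rwa [div_le_iff₀ hT]
        have e : -(1 / T) * v ^ 2 = -(v ^ 2 / T) := by ring
        linarith
      simp only [hφ]
      nlinarith [sq_nonneg ‖trigSum s c l v‖]
  have h2 : ∫ v in α..β, φ v ≤ ∫ v, φ v := by
    rw [intervalIntegral.integral_of_le hαβ]
    exact MeasureTheory.setIntegral_le_integral hφint (Filter.Eventually.of_forall hφ0)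
  have h3 : ∫ v, φ v ≤ √(Real.pi * T) *
      ∑ i ∈ s, ∑ j ∈ s, Real.exp (-(Real.pi ^ 2 * T * (l i - l j) ^ 2)) := by
    have e : ∫ v, φ v = ‖∫ v, ((φ v : ℝ) : ℂ)‖ := by
      rw [integral_complex_ofReal, Complex.norm_real, Real.norm_of_nonneg]
      exact MeasureTheory.integral_nonneg hφ0
    rw [e]
    simp only [hφ, norm_sq_trigSum_mul_gaussian]
    rw [MeasureTheory.integral_finsetSum _ fun i _ =>
      MeasureTheory.integrable_finsetSum _ fun j _ =>
        (integrable_eTwoPi_mul_gaussian hT _).const_mul _, Finset.mul_sum]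
    refine (norm_sum_le _ _).trans (Finset.sum_le_sum fun i hi => ?_)
    rw [MeasureTheory.integral_finsetSum _ fun j _ =>
        (integrable_eTwoPi_mul_gaussian hT _).const_mul _, Finset.mul_sum]
    refine (norm_sum_le _ _).trans (Finset.sum_le_sum fun j hj => ?_)
    rw [MeasureTheory.integral_const_mul, norm_mul, norm_integral_eTwoPi_mul_gaussian hT, norm_mul,
      RCLike.norm_conj]
    have := mul_le_one₀ (hc i hi) (norm_nonneg _) (hc j hj)
    exact mul_le_of_le_one_left (by positivity) this
  rw [intervalIntegral.integral_const_mul] at h1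
  refine h1.trans ?_
  gcongr
  exact h2.trans h3

/-- Gallagher's inequality on a single interval. -/
theorem norm_sq_le_integral {f f' : ℝ → ℂ} (hf : ∀ v, HasDerivAt f (f' v) v) (hf' : Continuous f')
    {X δ y z : ℝ} (hX : 0 < X) (hδ : 0 < δ) (hyz : y + δ ≤ z) :
    ‖f y‖ ^ 2 ≤ ∫ v in y..z, ((δ⁻¹ + X) * ‖f v‖ ^ 2 + X⁻¹ * ‖f' v‖ ^ 2) := by
  have hcf : Continuous f := continuous_iff_continuousAt.mpr fun v => (hf v).continuousAt
  have hsq : Continuous fun v => ‖f v‖ ^ 2 := by fun_prop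
  have hle : y ≤ z := by linarith
  set ψ : ℝ → ℝ := fun v => X * ‖f v‖ ^ 2 + X⁻¹ * ‖f' v‖ ^ 2 with hψ
  have hcψ : Continuous ψ := by fun_prop
  have hψ0 : ∀ v, 0 ≤ ψ v := fun v => by positivity
  have hderiv : ∀ v, HasDerivAt (fun v => ‖f v‖ ^ 2) (2 * inner ℝ (f v) (f' v)) v :=
    fun v => (hf v).norm_sq
  have hcd : Continuous fun v => 2 * inner ℝ (f v) (f' v) := by fun_prop
  have hpt : ∀ t ∈ Set.Icc y z, ‖f y‖ ^ 2 ≤ ‖f t‖ ^ 2 + ∫ v in y..z, ψ v := by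
    intro t ht
    have e := intervalIntegral.integral_eq_sub_of_hasDerivAt (a := y) (b := t)
      (fun v _ => hderiv v) (hcd.intervalIntegrable _ _)
    have e1 : -∫ v in y..t, 2 * inner ℝ (f v) (f' v) ≤ ∫ v in y..t, ψ v := by
      rw [← intervalIntegral.integral_neg]
      apply intervalIntegral.integral_mono_on ht.1 (hcd.neg.intervalIntegrable _ _)
        (hcψ.intervalIntegrable _ _)
      intro v _
      have i1 := (abs_le.mp (abs_real_inner_le_norm (f v) (f' v))).1
      have i2 : 2 * (‖f v‖ * ‖f' v‖) ≤ ψ v := by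
        have : ψ v - 2 * (‖f v‖ * ‖f' v‖) = X⁻¹ * (X * ‖f v‖ - ‖f' v‖) ^ 2 := by
          simp only [hψ]; field_simp; ring
        have : 0 ≤ ψ v - 2 * (‖f v‖ * ‖f' v‖) := by rw [this]; positivity
        linarith
      simp only [Pi.neg_apply]
      linarith
    have e2 : ∫ v in y..t, ψ v ≤ ∫ v in y..z, ψ v :=
      intervalIntegral.integral_mono_interval le_rfl ht.1 ht.2
        (Filter.Eventually.of_forall hψ0) (hcψ.intervalIntegrable _ _)
    linarith
  have havg : (z - y) * ‖f y‖ ^ 2 ≤ (∫ v in y..z, ‖f v‖ ^ 2) + (z - y) * ∫ v in y..z, ψ v := by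
    have := intervalIntegral.integral_mono_on hle (intervalIntegrable_const)
      ((hsq.intervalIntegrable _ _).add (intervalIntegrable_const (μ := MeasureTheory.volume))) hpt
    rw [intervalIntegral.integral_const, intervalIntegral.integral_add
      (hsq.intervalIntegrable _ _) (intervalIntegrable_const),
      intervalIntegral.integral_const] at this
    simpa using this
  have hsplit : ∫ v in y..z, ((δ⁻¹ + X) * ‖f v‖ ^ 2 + X⁻¹ * ‖f' v‖ ^ 2)
      = δ⁻¹ * (∫ v in y..z, ‖f v‖ ^ 2) + ∫ v in y..z, ψ v := by
    rw [← intervalIntegral.integral_const_mul, ← intervalIntegral.integral_add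
      ((hsq.const_mul _).intervalIntegrable _ _) (hcψ.intervalIntegrable _ _)]
    refine intervalIntegral.integral_congr fun v _ => ?_
    simp only [hψ]
    ring
  have hI0 : 0 ≤ ∫ v in y..z, ‖f v‖ ^ 2 :=
    intervalIntegral.integral_nonneg hle fun v _ => by positivity
  rw [hsplit]
  have hzy : 0 < z - y := by linarith
  have h1 : ‖f y‖ ^ 2 ≤ (z - y)⁻¹ * (∫ v in y..z, ‖f v‖ ^ 2) + ∫ v in y..z, ψ v := by
    have := mul_le_mul_of_nonneg_left havg (inv_pos.mpr hzy).le
    rw [mul_add, inv_mul_cancel_left₀ hzy.ne', inv_mul_cancel_left₀ hzy.ne'] at this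
    exact this
  have h2 : (z - y)⁻¹ ≤ δ⁻¹ := by gcongr; linarith
  nlinarith

/-- Large sieve inequality for the points `y m, …, y (n - 1)`, with a Gaussian kernel. -/
theorem sum_norm_sq_trigSum_le {T Λ δ : ℝ} {y : ℕ → ℝ} {m n : ℕ} (hmn : m ≤ n) (hT : 0 < T)
    (hΛ : 0 < Λ) (hδ : 0 < δ) (hy : ∀ k ∈ Finset.Ico m n, y k + δ ≤ y (k + 1)) (hym : 0 ≤ y m)
    (hymn : y m ≤ y n)
    (hyn : y n ^ 2 ≤ 3 * T) (hc : ∀ i ∈ s, ‖c i‖ ≤ 1) (hl : ∀ i ∈ s, |l i| ≤ Λ) :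
    ∑ k ∈ Finset.Ico m n, ‖trigSum s c l (y k)‖ ^ 2 ≤ (δ⁻¹ + 4 * Real.pi * Λ) *
      (Real.exp 3 * (√(Real.pi * T) *
        ∑ i ∈ s, ∑ j ∈ s, Real.exp (-(Real.pi ^ 2 * T * (l i - l j) ^ 2)))) := by
  set X := 2 * Real.pi * Λ with hX
  have hX0 : 0 < X := by positivity
  set c' : ι → ℂ := fun i => c i * (Complex.I * (l i / Λ : ℝ)) with hc'
  set f' := trigSum s (fun i => c i * (2 * Real.pi * Complex.I * l i)) l with hf'
  have hcf := continuous_trigSum s c l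
  have hcf' : Continuous f' := continuous_trigSum _ _ _
  have hff' : ∀ v, ‖f' v‖ ^ 2 = X ^ 2 * ‖trigSum s c' l v‖ ^ 2 := by
    intro v
    have : f' v = X * trigSum s c' l v := by
      simp only [hf', trigSum, hc', hX, Finset.mul_sum]
      refine Finset.sum_congr rfl fun i _ => ?_
      push_cast
      have : (Λ : ℂ) ≠ 0 := by exact_mod_cast hΛ.ne'
      field_simp
    rw [this, norm_mul, mul_pow, Complex.norm_real, Real.norm_of_nonneg hX0.le]
  have hc'1 : ∀ i ∈ s, ‖c' i‖ ≤ 1 := by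
    intro i hi
    simp only [hc', norm_mul, Complex.norm_I, one_mul, Complex.norm_real, Real.norm_eq_abs, abs_div,
      abs_of_pos hΛ]
    exact mul_le_one₀ (hc i hi) (by positivity) ((div_le_one hΛ).mpr (hl i hi))
  have b1 := integral_norm_sq_trigSum_le s c l hT hym hymn hyn hc
  have b2 := integral_norm_sq_trigSum_le s c' l hT hym hymn hyn hc'1
  calc ∑ k ∈ Finset.Ico m n, ‖trigSum s c l (y k)‖ ^ 2
      ≤ ∑ k ∈ Finset.Ico m n, ∫ v in y k..y (k + 1),
          ((δ⁻¹ + X) * ‖trigSum s c l v‖ ^ 2 + X⁻¹ * ‖f' v‖ ^ 2) :=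
        Finset.sum_le_sum fun k hk =>
          norm_sq_le_integral (hasDerivAt_trigSum s c l) hcf' hX0 hδ (hy k hk)
    _ = ∫ v in y m..y n, ((δ⁻¹ + X) * ‖trigSum s c l v‖ ^ 2 + X⁻¹ * ‖f' v‖ ^ 2) := by
        apply intervalIntegral.sum_integral_adjacent_intervals_Ico hmn
        intro k _
        apply Continuous.intervalIntegrable
        fun_prop
    _ = (δ⁻¹ + X) * (∫ v in y m..y n, ‖trigSum s c l v‖ ^ 2)
        + X * ∫ v in y m..y n, ‖trigSum s c' l v‖ ^ 2 := by
        have hcc := continuous_trigSum s c' l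
        rw [← intervalIntegral.integral_const_mul, ← intervalIntegral.integral_const_mul,
          ← intervalIntegral.integral_add]
        · refine intervalIntegral.integral_congr fun v _ => ?_
          simp only [hff']
          field_simp
        all_goals
          apply Continuous.intervalIntegrable
          fun_prop
    _ ≤ _ := by
        have := mul_le_mul_of_nonneg_left b1 (show 0 ≤ δ⁻¹ + X by positivity)
        have := mul_le_mul_of_nonneg_left b2 hX0.le
        simp only [hX] at *
        linarith

end trigSum

theorem exp_kernel_le {H N d h₁ h₂ a₁ a₂ : ℝ} (hH : 0 < H) (hN : 0 < N) (hd : 0 < d)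
    (p1 : 0 < h₁) (p1' : h₁ ≤ 2 * H) (p2 : 0 < h₂) (p2' : h₂ ≤ 2 * H)
    (q1 : 0 < a₁) (q1' : a₁ ≤ 2 * N) (q2 : 0 < a₂) (q2' : a₂ ≤ 2 * N) :
    Real.exp (-(Real.pi ^ 2 * N * (h₁ * √a₁ / d - h₂ * √a₂ / d) ^ 2))
      ≤ 2 * Real.exp 1 * (1 / 2 : ℝ) ^ ⌈|h₁ ^ 2 * a₁ - h₂ ^ 2 * a₂| / (H * d)⌉₊ := by
  refine le_trans (Real.exp_le_exp.mpr ?_) (exp_neg_sq_le_two_pow_ceil (by positivity))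
  rw [neg_le_neg_iff]
  set k := h₁ ^ 2 * a₁ - h₂ ^ 2 * a₂ with hk
  set D := h₁ * √a₁ + h₂ * √a₂ with hD
  have hD0 : 0 < D := by positivity
  have hs1 := Real.sq_sqrt q1.le
  have hs2 := Real.sq_sqrt q2.le
  have hkD : k = D * (h₁ * √a₁ - h₂ * √a₂) := by
    rw [hk, hD]; nlinarith
  have hDle : D ^ 2 ≤ 32 * H ^ 2 * N := by
    have e1 : D ≤ 2 * H * (2 * √(2 * N)) := by
      have : √a₁ ≤ √(2 * N) := Real.sqrt_le_sqrt q1'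
      have : √a₂ ≤ √(2 * N) := Real.sqrt_le_sqrt q2'
      calc D ≤ 2 * H * √(2 * N) + 2 * H * √(2 * N) := by rw [hD]; gcongr
        _ = _ := by ring
    calc D ^ 2 ≤ (2 * H * (2 * √(2 * N))) ^ 2 := by gcongr
      _ = 16 * H ^ 2 * √(2 * N) ^ 2 := by ring
      _ = _ := by rw [Real.sq_sqrt (by positivity)]; ring
  set w := h₁ * √a₁ - h₂ * √a₂
  have hpi : 8 ≤ Real.pi ^ 2 := by nlinarith [Real.pi_gt_three]
  calc (|k| / (H * d)) ^ 2 / 4 = D ^ 2 * (w ^ 2 / (4 * H ^ 2 * d ^ 2)) := by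
        rw [div_pow, sq_abs, hkD]; field_simp
    _ ≤ 32 * H ^ 2 * N * (w ^ 2 / (4 * H ^ 2 * d ^ 2)) := by gcongr
    _ = 8 * N * (w / d) ^ 2 := by field_simp; ring
    _ ≤ Real.pi ^ 2 * N * (w / d) ^ 2 := by gcongr
    _ = _ := by rw [← sub_div]

theorem kernel_sum_le {H N d L : ℝ} (hH : 1 ≤ H) (hN : 1 ≤ N) (hd : 1 ≤ d)
    (hL1 : 1 ≤ L) (hL : Real.log (2 * H) ≤ L) (s : Finset (ℕ × ℕ))
    (hs1 : ∀ i ∈ s, H ≤ i.1 ∧ (i.1 : ℝ) ≤ 2 * H) (hs2 : ∀ i ∈ s, N ≤ i.2 ∧ (i.2 : ℝ) ≤ 2 * N) :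
    ∑ i ∈ s, ∑ j ∈ s, Real.exp (-(Real.pi ^ 2 * N *
      ((i.1 : ℝ) * √(i.2 : ℝ) / d - (j.1 : ℝ) * √(j.2 : ℝ) / d) ^ 2))
      ≤ 1024 * Real.exp 1 * (H * N * d * L) := by
  have hH0 : 0 < H := by linarith
  have hN0 : 0 < N := by linarith
  have hd0 : 0 < d := by linarith
  rw [← Finset.sum_product']
  have key := sum_two_pow_ceil_le (s ×ˢ s)
    (fun x => |(x.1.1 : ℝ) ^ 2 * x.1.2 - (x.2.1 : ℝ) ^ 2 * x.2.2| / (H * d))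
    (R := 128 * (H * N * d * L)) (by
      intro j
      have := card_quadruples_le (K := j * (H * d)) hH hN (by positivity)
        ((s ×ˢ s).filter fun x =>
          |(x.1.1 : ℝ) ^ 2 * x.1.2 - (x.2.1 : ℝ) ^ 2 * x.2.2| / (H * d) ≤ j)
        (fun x hx => hs1 _ (Finset.mem_product.mp (Finset.mem_filter.mp hx).1).1)
        (fun x hx => hs1 _ (Finset.mem_product.mp (Finset.mem_filter.mp hx).1).2)
        (fun x hx => hs2 _ (Finset.mem_product.mp (Finset.mem_filter.mp hx).1).1)
        (fun x hx => hs2 _ (Finset.mem_product.mp (Finset.mem_filter.mp hx).1).2)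
        (fun x hx => (div_le_iff₀ (by positivity)).mp (Finset.mem_filter.mp hx).2)
      refine this.trans ?_
      have e1 : 16 * H * N * (1 + Real.log (2 * H)) ≤ 16 * H * N * (L + L) := by gcongr
      have e2 : H * N * L * 1 ≤ H * N * L * d := by gcongr
      have e3 : H * N * d * j * 1 ≤ H * N * d * j * L := by gcongr
      have e4 : 0 ≤ H * N * d * L := by positivity
      nlinarith)
  calc _ ≤ ∑ x ∈ s ×ˢ s, 2 * Real.exp 1 * (1 / 2 : ℝ) ^
        ⌈|(x.1.1 : ℝ) ^ 2 * x.1.2 - (x.2.1 : ℝ) ^ 2 * x.2.2| / (H * d)⌉₊ := by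
        refine Finset.sum_le_sum fun x hx => ?_
        obtain ⟨hx1, hx2⟩ := Finset.mem_product.mp hx
        exact exp_kernel_le hH0 hN0 hd0 (hH0.trans_le (hs1 _ hx1).1) (hs1 _ hx1).2
          (hH0.trans_le (hs1 _ hx2).1) (hs1 _ hx2).2 (hN0.trans_le (hs2 _ hx1).1) (hs2 _ hx1).2
          (hN0.trans_le (hs2 _ hx2).1) (hs2 _ hx2).2
    _ ≤ _ := by
        rw [← Finset.mul_sum]
        have := mul_le_mul_of_nonneg_left key (show 0 ≤ 2 * Real.exp 1 by positivity)
        linarith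

theorem sum_norm_sq_trigSum_sqrt_le {H L : ℝ} {N d : ℕ} (hH : 1 ≤ H) (hN : 1 ≤ N) (hd : 1 ≤ d)
    (hL1 : 1 ≤ L) (hL : Real.log (2 * H) ≤ L) (s : Finset (ℕ × ℕ))
    (hs1 : ∀ i ∈ s, H ≤ i.1 ∧ (i.1 : ℝ) ≤ 2 * H)
    (hs2 : ∀ i ∈ s, (N : ℝ) ≤ i.2 ∧ (i.2 : ℝ) ≤ 2 * N)
    (c : ℕ × ℕ → ℂ) (hc : ∀ i ∈ s, ‖c i‖ ≤ 1) :
    ∑ b ∈ Finset.Icc (N + 1) (2 * N),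
        ‖trigSum s c (fun i => (i.1 : ℝ) * √(i.2 : ℝ) / d) √(b : ℝ)‖ ^ 2
      ≤ 65536 * Real.pi * √Real.pi * Real.exp 4 * ((N : ℝ) ^ 2 * H * (d + H) * L) := by
  have hH0 : 0 < H := by linarith
  have hN1 : (1 : ℝ) ≤ N := by exact_mod_cast hN
  have hN0 : (0 : ℝ) < N := by linarith
  have hd1 : (1 : ℝ) ≤ d := by exact_mod_cast hd
  have hd0 : (0 : ℝ) < d := by linarith
  have hker := kernel_sum_le hH hN1 hd1 hL1 hL s hs1 hs2
  have hls := sum_norm_sq_trigSum_le s c (fun i => (i.1 : ℝ) * √(i.2 : ℝ) / d) (T := N)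
    (Λ := 4 * H * √N / d) (δ := (4 * √N)⁻¹) (y := fun k => √(k : ℝ)) (m := N + 1) (n := 2 * N + 1)
    (by omega) hN0 (by positivity) (by positivity) ?_ (by positivity)
    (Real.sqrt_le_sqrt (by push_cast; linarith)) ?_ hc ?_
  · have hIco : Finset.Ico (N + 1) (2 * N + 1) = Finset.Icc (N + 1) (2 * N) := by
      ext; simp only [Finset.mem_Ico, Finset.mem_Icc]; omega
    rw [hIco, inv_inv] at hls
    refine hls.trans ?_
    calc _ ≤ (4 * √N + 4 * Real.pi * (4 * H * √N / d)) * (Real.exp 3 * (√(Real.pi * N) *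
            (1024 * Real.exp 1 * (H * N * d * L)))) := by gcongr
      _ = 4096 * √Real.pi * (Real.exp 3 * Real.exp 1) * √N ^ 2 * N *
            (H * (d + 4 * Real.pi * H) * L) := by
          rw [Real.sqrt_mul Real.pi_pos.le]
          field_simp
          ring
      _ = 4096 * √Real.pi * Real.exp 4 * N ^ 2 * (H * (d + 4 * Real.pi * H) * L) := by
          rw [← Real.exp_add, Real.sq_sqrt hN0.le]
          rw [show (3 : ℝ) + 1 = 4 by norm_num]
          ring
      _ ≤ 4096 * √Real.pi * Real.exp 4 * N ^ 2 * (H * (16 * Real.pi * (d + H)) * L) := by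
          gcongr
          nlinarith [Real.pi_gt_three]
      _ = _ := by ring
  · intro k hk
    rw [Finset.mem_Ico] at hk
    have k1 : (k : ℝ) + 1 ≤ 4 * N := by
      have : k + 1 ≤ 4 * N := by omega
      exact_mod_cast this
    have e1 : √((k : ℝ) + 1) ≤ 2 * √N := by
      rw [show 2 * √(N : ℝ) = √(4 * N) by
        rw [Real.sqrt_mul (by norm_num), show (4 : ℝ) = 2 ^ 2 by norm_num,
          Real.sqrt_sq (by norm_num)]]
      exact Real.sqrt_le_sqrt k1
    have e2 : √(k : ℝ) ≤ √((k : ℝ) + 1) := Real.sqrt_le_sqrt (by linarith)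
    have e3 := Real.sq_sqrt (show (0 : ℝ) ≤ k by positivity)
    have e4 := Real.sq_sqrt (show (0 : ℝ) ≤ k + 1 by positivity)
    push_cast
    rw [← le_sub_iff_add_le', inv_le_iff_one_le_mul₀' (by positivity)]
    nlinarith
  · rw [Real.sq_sqrt (by positivity)]
    push_cast
    linarith
  · intro i hi
    rw [abs_of_nonneg (by positivity)]
    refine div_le_div_of_nonneg_right ?_ hd0.le
    have e1 : √(i.2 : ℝ) ≤ 2 * √N := by
      rw [show 2 * √(N : ℝ) = √(4 * N) by
        rw [Real.sqrt_mul (by norm_num), show (4 : ℝ) = 2 ^ 2 by norm_num,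
          Real.sqrt_sq (by norm_num)]]
      exact Real.sqrt_le_sqrt (by linarith [(hs2 i hi).2])
    calc (i.1 : ℝ) * √(i.2 : ℝ) ≤ (2 * H) * (2 * √N) := by
          gcongr
          exact (hs1 i hi).2
      _ = _ := by ring

theorem norm_sq_bilinear_sum_le {H L : ℝ} {N d : ℕ} (hH : 1 ≤ H) (hN : 1 ≤ N) (hd : 1 ≤ d)
    (hL1 : 1 ≤ L) (hL : Real.log (2 * H) ≤ L) {A B : Finset ℕ}
    (hA : A ⊆ Finset.Icc (N + 1) (2 * N)) (hB : B ⊆ Finset.Icc (N + 1) (2 * N))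
    (c : ℤ → ℂ) (hc : ∀ h ∈ Finset.Ioc ⌊H⌋ ⌊2 * H⌋, ‖c h‖ ≤ 1) :
    ‖∑ h ∈ Finset.Ioc ⌊H⌋ ⌊2 * H⌋,
        c h * ∑ a ∈ A, ∑ b ∈ B, eTwoPi (h * Real.sqrt (a * b) / d)‖ ^ 2
      ≤ B.card * (65536 * Real.pi * √Real.pi * Real.exp 4 * ((N : ℝ) ^ 2 * H * (d + H) * L)) := by
  have hH0 : 0 ≤ H := by linarith
  set I := Finset.Ioc ⌊H⌋₊ ⌊2 * H⌋₊ with hI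
  have hIoc : Finset.Ioc ⌊H⌋ ⌊2 * H⌋ = I.map Nat.castEmbedding := by
    rw [← Finset.coe_inj, Finset.coe_map, hI, Finset.coe_Ioc, Finset.coe_Ioc]
    rw [← Int.natCast_floor_eq_floor hH0, ← Int.natCast_floor_eq_floor (by linarith : 0 ≤ 2 * H)]
    exact (Nat.image_cast_int_Ioc _ _).symm
  have hmem : ∀ h ∈ I, H ≤ (h : ℝ) ∧ (h : ℝ) ≤ 2 * H := by
    intro h hh
    rw [hI, Finset.mem_Ioc] at hh
    exact ⟨((Nat.floor_lt hH0).mp hh.1).le, (Nat.le_floor_iff (by linarith)).mp hh.2⟩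
  rw [hIoc, Finset.sum_map]
  rw [hIoc, Finset.forall_mem_map] at hc
  simp only [Nat.castEmbedding_apply, Int.cast_natCast] at hc ⊢
  set l : ℕ × ℕ → ℝ := fun i => (i.1 : ℝ) * √(i.2 : ℝ) / d with hl
  have hsum : ∑ h ∈ I, c h * ∑ a ∈ A, ∑ b ∈ B, eTwoPi (h * Real.sqrt (a * b) / d)
      = ∑ b ∈ B, trigSum (I ×ˢ A) (fun i => c i.1) l √(b : ℝ) := by
    simp only [trigSum, Finset.sum_product]
    rw [Finset.sum_comm (s := B)]
    refine Finset.sum_congr rfl fun h _ => ?_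
    rw [Finset.sum_comm (s := B), Finset.mul_sum]
    refine Finset.sum_congr rfl fun a _ => ?_
    rw [Finset.mul_sum]
    refine Finset.sum_congr rfl fun b _ => ?_
    rw [hl, Real.sqrt_mul (Nat.cast_nonneg a), div_mul_eq_mul_div, mul_assoc]
  rw [hsum]
  have hb := sum_norm_sq_trigSum_sqrt_le hH hN hd hL1 hL (I ×ˢ A)
    (fun i hi => hmem _ (Finset.mem_product.mp hi).1)
    (fun i hi => by
      have := Finset.mem_Icc.mp (hA (Finset.mem_product.mp hi).2)
      exact ⟨by exact_mod_cast (by omega : N ≤ i.2), by exact_mod_cast this.2⟩)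
    (fun i => c i.1) (fun i hi => hc _ (Finset.mem_product.mp hi).1)
  calc _ ≤ (∑ b ∈ B, ‖trigSum (I ×ˢ A) (fun i => c i.1) l √(b : ℝ)‖) ^ 2 := by
        gcongr
        exact norm_sum_le _ _
    _ ≤ B.card * ∑ b ∈ B, ‖trigSum (I ×ˢ A) (fun i => c i.1) l √(b : ℝ)‖ ^ 2 :=
        sq_sum_le_card_mul_sum_sq
    _ ≤ B.card * ∑ b ∈ Finset.Icc (N + 1) (2 * N),
          ‖trigSum (I ×ˢ A) (fun i => c i.1) l √(b : ℝ)‖ ^ 2 := by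
        gcongr
    _ ≤ _ := by gcongr

/-- **Estimate (3.25).** For coefficients `c(h)` bounded by `1`,
`|Σ_{h∼H₁} c(h) Σ_{a∈𝔄} Σ_{b∈𝔅} e(h√(ab)/d)|
  ≪ N H₁ (|𝔄||𝔅|)^{1/4} (1 + d^{1/2} H₁^{−1/2}) (log 2NH₁)^{1/2}`. -/
theorem exponential_sum_bound_d :
    ∃ C : ℝ, 0 < C ∧ ∀ N : ℕ, 2 ≤ N →
      ∀ A B : Finset ℕ, A ⊆ Finset.Icc (N + 1) (2 * N) → B ⊆ Finset.Icc (N + 1) (2 * N) →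
        ∀ d : ℕ, 1 ≤ d → ∀ H₁ : ℝ, 1 ≤ H₁ →
          ∀ c : ℤ → ℂ, (∀ h ∈ Finset.Ioc ⌊H₁⌋ ⌊2 * H₁⌋, ‖c h‖ ≤ 1) →
            ‖∑ h ∈ Finset.Ioc ⌊H₁⌋ ⌊2 * H₁⌋,
                c h * ∑ a ∈ A, ∑ b ∈ B, eTwoPi (h * Real.sqrt (a * b) / d)‖ ≤
              C * N * H₁ * ((A.card : ℝ) * B.card) ^ ((1 : ℝ) / 4) *
                (1 + (d : ℝ) ^ ((1 : ℝ) / 2) * H₁ ^ (-(1 : ℝ) / 2)) *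
                (Real.log (2 * N * H₁)) ^ ((1 : ℝ) / 2) := by
  have hC0 : (0 : ℝ) < 65536 * Real.pi * √Real.pi * Real.exp 4 := by positivity
  refine ⟨√(65536 * Real.pi * √Real.pi * Real.exp 4), Real.sqrt_pos.mpr hC0, ?_⟩
  intro N hN A B hA hB d hd H hH c hc
  have hN2 : (2 : ℝ) ≤ N := by exact_mod_cast hN
  have hH0 : 0 < H := by linarith
  set L := Real.log (2 * N * H) with hLdef
  have hL1 : 1 ≤ L := by
    rw [hLdef, Real.le_log_iff_exp_le (by positivity)]
    nlinarith [Real.exp_one_lt_d9]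
  have hL : Real.log (2 * H) ≤ L := by
    apply Real.log_le_log (by positivity)
    nlinarith
  have h1 := norm_sq_bilinear_sum_le hH (by omega : 1 ≤ N) hd hL1 hL hA hB c hc
  have h2 := norm_sq_bilinear_sum_le hH (by omega : 1 ≤ N) hd hL1 hL hB hA c hc
  have hswap : ∑ h ∈ Finset.Ioc ⌊H⌋ ⌊2 * H⌋,
        c h * ∑ a ∈ B, ∑ b ∈ A, eTwoPi (h * Real.sqrt (a * b) / d)
      = ∑ h ∈ Finset.Ioc ⌊H⌋ ⌊2 * H⌋,
        c h * ∑ a ∈ A, ∑ b ∈ B, eTwoPi (h * Real.sqrt (a * b) / d) := by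
    refine Finset.sum_congr rfl fun h _ => ?_
    rw [Finset.sum_comm]
    simp only [mul_comm]
  rw [hswap] at h2
  set S := ‖∑ h ∈ Finset.Ioc ⌊H⌋ ⌊2 * H⌋,
        c h * ∑ a ∈ A, ∑ b ∈ B, eTwoPi (h * Real.sqrt (a * b) / d)‖ with hS
  set C := 65536 * Real.pi * √Real.pi * Real.exp 4 with hC
  set E := C * ((N : ℝ) ^ 2 * H * (d + H) * L) with hE
  have hE0 : 0 ≤ E := by positivity
  have hS4 : S ^ 2 ≤ √((A.card : ℝ) * B.card) * E := by
    rw [← Real.sqrt_sq hE0, ← Real.sqrt_mul (by positivity)]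
    apply Real.le_sqrt_of_sq_le
    calc (S ^ 2) ^ 2 = S ^ 2 * S ^ 2 := by ring
      _ ≤ (A.card * E) * (B.card * E) := by gcongr
      _ = _ := by ring
  have r1 : (((A.card : ℝ) * B.card) ^ ((1 : ℝ) / 4)) ^ 2 = √((A.card : ℝ) * B.card) := by
    rw [← Real.rpow_natCast, ← Real.rpow_mul (by positivity), Real.sqrt_eq_rpow]
    norm_num
  have r2 : ((d : ℝ) ^ ((1 : ℝ) / 2) * H ^ (-(1 : ℝ) / 2)) ^ 2 = d / H := by
    rw [mul_pow, ← Real.rpow_natCast, ← Real.rpow_natCast, ← Real.rpow_mul (by positivity),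
      ← Real.rpow_mul (by positivity)]
    norm_num
    rw [Real.rpow_neg_one, div_eq_mul_inv]
  have r3 : (L ^ ((1 : ℝ) / 2)) ^ 2 = L := by
    rw [← Real.sqrt_eq_rpow, Real.sq_sqrt (by linarith)]
  have q0 : 0 ≤ (d : ℝ) ^ ((1 : ℝ) / 2) * H ^ (-(1 : ℝ) / 2) := by positivity
  set q := (d : ℝ) ^ ((1 : ℝ) / 2) * H ^ (-(1 : ℝ) / 2)
  apply le_of_sq_le_sq _ (by positivity)
  rw [mul_pow, mul_pow, mul_pow, mul_pow, mul_pow, r1, r3, Real.sq_sqrt hC0.le]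
  refine hS4.trans ?_
  have hq : 1 + d / H ≤ (1 + q) ^ 2 := by nlinarith
  calc √((A.card : ℝ) * B.card) * E
      = C * N ^ 2 * H ^ 2 * √((A.card : ℝ) * B.card) * (1 + d / H) * L := by
        rw [hE]; field_simp; ring
    _ ≤ _ := by gcongr
end
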